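/- arXiv:1710.10524 — 4 statements merged into one kernel-verified Lean document; each statement's English description precedes it below -/
import Mathlib

section
/- Let D = (E, 𝓕) be a delta-matroid, let < be a total order on E, and let F ∈ 𝓕. Define a sequence of minors as follows: start with D; while the current minor D' has a nonsingular point, let a be the highest-ordered nonsingular point of D' and replace D' by D'/a if a ∈ F and by D'∖a if a ∉ F; let L(F) be the final minor, all of whose points are singular. Then a point a ∈ E belongs to the ground set of L(F) if and only if a is active with respect to F and F-orientable. -/
open Finset

/-- The symmetric exchange axiom for a collection of feasible sets. -/
def SymExch {α : Type*} [DecidableEq α] (𝓕 : Finset (Finset α)) : Prop :=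
  ∀ X ∈ 𝓕, ∀ Y ∈ 𝓕, ∀ a ∈ symmDiff X Y, ∃ b ∈ symmDiff X Y, symmDiff X {a, b} ∈ 𝓕

/-- A point `a` is `F`-nonorientable if `F Δ {a}` is feasible. -/
def FNonorientable {α : Type*} [DecidableEq α] (𝓕 : Finset (Finset α))
    (F : Finset α) (a : α) : Prop :=
  symmDiff F {a} ∈ 𝓕

/-- Distinct points `a` and `b` are `F`-interlaced if either at most one of
them is `F`-nonorientable and `F Δ {a,b}` is feasible, or both are
`F`-nonorientable and `F Δ {a,b}` is not feasible. -/
def FInterlaced {α : Type*} [DecidableEq α] (𝓕 : Finset (Finset α))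
    (F : Finset α) (a b : α) : Prop :=
  a ≠ b ∧
    ((¬(FNonorientable 𝓕 F a ∧ FNonorientable 𝓕 F b) ∧ symmDiff F {a, b} ∈ 𝓕) ∨
      (FNonorientable 𝓕 F a ∧ FNonorientable 𝓕 F b ∧ symmDiff F {a, b} ∉ 𝓕))

/-- A point is active with respect to `F` if no lower-ordered point is
`F`-interlaced with it. -/
def ActiveWrt {α : Type*} [LinearOrder α] (𝓕 : Finset (Finset α))
    (F : Finset α) (a : α) : Prop :=
  ∀ b, b < a → ¬ FInterlaced 𝓕 F b a

/-- A point is nonsingular in a delta-matroid with feasible sets `𝓕'` if it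
is neither a loop nor a coloop. -/
def Nonsing {α : Type*} (𝓕' : Finset (Finset α)) (a : α) : Prop :=
  (∃ F ∈ 𝓕', a ∈ F) ∧ (∃ F ∈ 𝓕', a ∉ F)

/-- `TreePath F E 𝓕 E' 𝓕'` records that the minor `(E', 𝓕')` arises from
`(E, 𝓕)` by repeatedly taking the highest-ordered nonsingular point `a` of
the current minor and contracting it if `a ∈ F`, deleting it otherwise. -/
inductive TreePath {α : Type*} [LinearOrder α] (F : Finset α)
    (E : Finset α) (𝓕 : Finset (Finset α)) :
    Finset α → Finset (Finset α) → Prop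
  | refl : TreePath F E 𝓕 E 𝓕
  | del {E' : Finset α} {𝓕' : Finset (Finset α)} {a : α} :
      TreePath F E 𝓕 E' 𝓕' → a ∈ E' → Nonsing 𝓕' a →
      (∀ b ∈ E', Nonsing 𝓕' b → b ≤ a) → a ∉ F →
      TreePath F E 𝓕 (E'.erase a) (𝓕'.filter (fun G => a ∉ G))
  | con {E' : Finset α} {𝓕' : Finset (Finset α)} {a : α} :
      TreePath F E 𝓕 E' 𝓕' → a ∈ E' → Nonsing 𝓕' a →
      (∀ b ∈ E', Nonsing 𝓕' b → b ≤ a) → a ∈ F →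
      TreePath F E 𝓕 (E'.erase a) ((𝓕'.filter (fun G => a ∈ G)).image (fun G => G.erase a))

def MinorInv {α : Type*} [LinearOrder α] (F E : Finset α) (𝓕 : Finset (Finset α))
    (E' : Finset α) (𝓕' : Finset (Finset α)) : Prop :=
  ∀ G, G ∈ 𝓕' ↔ ∃ X ∈ 𝓕, (∀ x ∈ E, x ∉ E' → (x ∈ X ↔ x ∈ F)) ∧ G = X ∩ E'

theorem nonsing_iff_adj {α : Type*} [LinearOrder α] {F E : Finset α} {𝓕 : Finset (Finset α)}
    (hsub : ∀ F ∈ 𝓕, F ⊆ E) (hex : SymExch 𝓕) (hF : F ∈ 𝓕)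
    {E' : Finset α} {𝓕' : Finset (Finset α)} (hinv : MinorInv F E 𝓕 E' 𝓕')
    {a : α} (ha : a ∈ E') :
    Nonsing 𝓕' a ↔ ∃ b ∈ E', symmDiff F {a, b} ∈ 𝓕 := by
  have key : ∀ X ∈ 𝓕, (∀ x ∈ E, x ∉ E' → (x ∈ X ↔ x ∈ F)) → a ∈ symmDiff F X →
      ∃ b ∈ E', symmDiff F {a, b} ∈ 𝓕 := by
    intro X hX hag hmem
    obtain ⟨b, hb, h⟩ := hex F hF X hX a hmem
    refine ⟨b, ?_, h⟩
    by_contra hbE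
    have h1 := hsub F hF
    have h2 := hsub X hX
    rw [Finset.mem_symmDiff] at hb
    have := hag b (by rcases hb with hb | hb; exacts [h1 hb.1, h2 hb.1]) hbE
    tauto
  constructor
  · rintro ⟨⟨G, hG, haG⟩, ⟨H, hH, haH⟩⟩
    obtain ⟨X, hX, hXa, rfl⟩ := (hinv G).1 hG
    obtain ⟨Y, hY, hYa, rfl⟩ := (hinv H).1 hH
    rw [Finset.mem_inter] at haG haH
    by_cases haF : a ∈ F
    · exact key Y hY hYa (by rw [Finset.mem_symmDiff]; tauto)
    · exact key X hX hXa (by rw [Finset.mem_symmDiff]; tauto)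
  · rintro ⟨b, hb, h⟩
    have h1 : F ∩ E' ∈ 𝓕' := (hinv _).2 ⟨F, hF, fun _ _ _ => Iff.rfl, rfl⟩
    have h2 : symmDiff F {a, b} ∩ E' ∈ 𝓕' := by
      refine (hinv _).2 ⟨_, h, ?_, rfl⟩
      intro x _ hx
      have hxa : x ≠ a := by rintro rfl; exact hx ha
      have hxb : x ≠ b := by rintro rfl; exact hx hb
      simp [Finset.mem_symmDiff, hxa, hxb]
    by_cases haF : a ∈ F
    · exact ⟨⟨_, h1, by simp [haF, ha]⟩, ⟨_, h2, by simp [Finset.mem_symmDiff, haF]⟩⟩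
    · exact ⟨⟨_, h2, by simp [Finset.mem_symmDiff, haF, ha]⟩, ⟨_, h1, by simp [haF]⟩⟩

theorem minorInv_del {α : Type*} [LinearOrder α] {F E : Finset α} {𝓕 : Finset (Finset α)}
    {E' : Finset α} {𝓕' : Finset (Finset α)} (hinv : MinorInv F E 𝓕 E' 𝓕')
    {a : α} (ha : a ∈ E') (haE : a ∈ E) (haF : a ∉ F) :
    MinorInv F E 𝓕 (E'.erase a) (𝓕'.filter (fun G => a ∉ G)) := by
  intro G
  rw [Finset.mem_filter, hinv]
  constructor
  · rintro ⟨⟨X, hX, hag, rfl⟩, haG⟩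
    have haX : a ∉ X := fun h => haG (Finset.mem_inter.2 ⟨h, ha⟩)
    refine ⟨X, hX, ?_, ?_⟩
    · intro x hx hxE
      by_cases hxa : x = a
      · subst hxa; tauto
      · exact hag x hx (fun h => hxE (Finset.mem_erase.2 ⟨hxa, h⟩))
    · ext x; simp only [Finset.mem_inter, Finset.mem_erase]
      constructor
      · rintro ⟨h1, h2⟩; exact ⟨h1, by rintro rfl; exact haX h1, h2⟩
      · tauto
  · rintro ⟨X, hX, hag, rfl⟩
    have haX : a ∉ X := fun h => haF ((hag a haE (by simp)).1 h)
    refine ⟨⟨X, hX, fun x hx hxE => hag x hx (fun h => hxE (Finset.mem_of_mem_erase h)), ?_⟩,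
      by simp⟩
    ext x; simp only [Finset.mem_inter, Finset.mem_erase]
    constructor
    · tauto
    · rintro ⟨h1, h2⟩; exact ⟨h1, by rintro rfl; exact haX h1, h2⟩

theorem minorInv_con {α : Type*} [LinearOrder α] {F E : Finset α} {𝓕 : Finset (Finset α)}
    {E' : Finset α} {𝓕' : Finset (Finset α)} (hinv : MinorInv F E 𝓕 E' 𝓕')
    {a : α} (ha : a ∈ E') (haE : a ∈ E) (haF : a ∈ F) :
    MinorInv F E 𝓕 (E'.erase a)
      ((𝓕'.filter (fun G => a ∈ G)).image (fun G => G.erase a)) := by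
  intro G
  simp only [Finset.mem_image, Finset.mem_filter]
  constructor
  · rintro ⟨H, ⟨hH, haH⟩, rfl⟩
    obtain ⟨X, hX, hag, rfl⟩ := (hinv H).1 hH
    have haX : a ∈ X := (Finset.mem_inter.1 haH).1
    refine ⟨X, hX, ?_, ?_⟩
    · intro x hx hxE
      by_cases hxa : x = a
      · subst hxa; tauto
      · exact hag x hx (fun h => hxE (Finset.mem_erase.2 ⟨hxa, h⟩))
    · ext x; simp only [Finset.mem_inter, Finset.mem_erase]; tauto
  · rintro ⟨X, hX, hag, rfl⟩
    have haX : a ∈ X := (hag a haE (by simp)).2 haF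
    refine ⟨X ∩ E', ⟨(hinv _).2 ⟨X, hX,
      fun x hx hxE => hag x hx (fun h => hxE (Finset.mem_of_mem_erase h)), rfl⟩,
      Finset.mem_inter.2 ⟨haX, ha⟩⟩, ?_⟩
    ext x; simp only [Finset.mem_inter, Finset.mem_erase]; tauto

def RemInv {α : Type*} [LinearOrder α] (F E : Finset α) (𝓕 : Finset (Finset α))
    (E' : Finset α) : Prop :=
  ∀ c ∈ E, c ∉ E' → (∃ d, d ≤ c ∧ symmDiff F {c, d} ∈ 𝓕) ∧
    ∀ b ∈ E', symmDiff F {c, b} ∈ 𝓕 → b ≤ c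

theorem remInv_step {α : Type*} [LinearOrder α] {F E : Finset α} {𝓕 : Finset (Finset α)}
    (hsub : ∀ F ∈ 𝓕, F ⊆ E) (hex : SymExch 𝓕) (hF : F ∈ 𝓕)
    {E' : Finset α} {𝓕' : Finset (Finset α)} (hinv : MinorInv F E 𝓕 E' 𝓕')
    (hrem : RemInv F E 𝓕 E')
    {a : α} (ha : a ∈ E') (hns : Nonsing 𝓕' a) (hmax : ∀ b ∈ E', Nonsing 𝓕' b → b ≤ a) :
    RemInv F E 𝓕 (E'.erase a) := by
  have hle : ∀ b ∈ E', symmDiff F {a, b} ∈ 𝓕 → b ≤ a := fun b hb h =>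
    hmax b hb ((nonsing_iff_adj hsub hex hF hinv hb).2 ⟨a, ha, by rwa [Finset.pair_comm]⟩)
  intro c hc hcE
  by_cases hca : c = a
  · subst hca
    obtain ⟨d, hd, h⟩ := (nonsing_iff_adj hsub hex hF hinv ha).1 hns
    exact ⟨⟨d, hle d hd h, h⟩, fun b hb => hle b (Finset.mem_of_mem_erase hb)⟩
  · obtain ⟨h1, h2⟩ := hrem c hc (fun h => hcE (Finset.mem_erase.2 ⟨hca, h⟩))
    exact ⟨h1, fun b hb => h2 b (Finset.mem_of_mem_erase hb)⟩

theorem treePath_inv {α : Type*} [LinearOrder α] {F E : Finset α} {𝓕 : Finset (Finset α)}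
    (hsub : ∀ F ∈ 𝓕, F ⊆ E) (hex : SymExch 𝓕) (hF : F ∈ 𝓕)
    {E' : Finset α} {𝓕' : Finset (Finset α)} (hpath : TreePath F E 𝓕 E' 𝓕') :
    E' ⊆ E ∧ MinorInv F E 𝓕 E' 𝓕' ∧ RemInv F E 𝓕 E' := by
  induction hpath with
  | refl =>
    refine ⟨Finset.Subset.refl _, ?_, fun c hc h => absurd hc h⟩
    intro G
    constructor
    · intro hG
      exact ⟨G, hG, fun x hx h => absurd hx h, (Finset.inter_eq_left.2 (hsub G hG)).symm⟩
    · rintro ⟨X, hX, -, rfl⟩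
      rwa [Finset.inter_eq_left.2 (hsub X hX)]
  | del _ ha hns hmax haF ih =>
    obtain ⟨h1, h2, h3⟩ := ih
    exact ⟨(Finset.erase_subset _ _).trans h1, minorInv_del h2 ha (h1 ha) haF,
      remInv_step hsub hex hF h2 h3 ha hns hmax⟩
  | con _ ha hns hmax haF ih =>
    obtain ⟨h1, h2, h3⟩ := ih
    exact ⟨(Finset.erase_subset _ _).trans h1, minorInv_con h2 ha (h1 ha) haF,
      remInv_step hsub hex hF h2 h3 ha hns hmax⟩

/-- A point of `E` lies in the ground set of the terminal minor `L(F)`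
(in which every point is singular) if and only if it is active with
respect to `F` and `F`-orientable. -/
theorem mem_leaf_iff_active_orientable {α : Type*} [LinearOrder α]
    (E : Finset α) (𝓕 : Finset (Finset α))
    (hne : 𝓕.Nonempty) (hsub : ∀ F ∈ 𝓕, F ⊆ E) (hex : SymExch 𝓕)
    (F : Finset α) (hF : F ∈ 𝓕)
    (E' : Finset α) (𝓕' : Finset (Finset α))
    (hpath : TreePath F E 𝓕 E' 𝓕')
    (hleaf : ∀ b ∈ E', ¬ Nonsing 𝓕' b) :
    ∀ a ∈ E, (a ∈ E' ↔ ActiveWrt 𝓕 F a ∧ ¬ FNonorientable 𝓕 F a) := by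
  obtain ⟨h1, h2, h3⟩ := treePath_inv hsub hex hF hpath
  have hself : ∀ a, symmDiff F {a, a} ∈ 𝓕 ↔ FNonorientable 𝓕 F a := by
    intro a; simp [FNonorientable]
  intro a ha
  constructor
  · intro haE'
    have hno : ∀ b, b ≤ a → symmDiff F {a, b} ∉ 𝓕 := by
      intro b hba h
      by_cases hb : b ∈ E'
      · exact hleaf a haE' ((nonsing_iff_adj hsub hex hF h2 haE').2 ⟨b, hb, h⟩)
      · have hne : b ≠ a := by rintro rfl; exact hb haE'
        have hbE : b ∈ E := by
          by_cases hbF : b ∈ F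
          · exact hsub F hF hbF
          · exact hsub _ h (by simp [Finset.mem_symmDiff, hbF])
        exact hne (le_antisymm hba ((h3 b hbE hb).2 a haE' (by rwa [Finset.pair_comm])))
    have hor : ¬ FNonorientable 𝓕 F a := fun h => hno a le_rfl ((hself a).2 h)
    refine ⟨?_, hor⟩
    rintro b hba ⟨-, ⟨-, h⟩ | ⟨-, h, -⟩⟩
    · exact hno b hba.le (by rwa [Finset.pair_comm])
    · exact hor h
  · rintro ⟨hact, hor⟩
    by_contra haE'
    obtain ⟨d, hda, h⟩ := (h3 a ha haE').1
    rcases hda.eq_or_lt with rfl | hlt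
    · exact hor ((hself _).1 h)
    · exact hact d hlt ⟨hlt.ne, Or.inl ⟨fun h => hor h.2, by rwa [Finset.pair_comm]⟩⟩
end

section
/- Let D = (E, 𝓕) be a delta-matroid and let < be any total order on E. Then for all real numbers w ≠ 0, x ≠ 0 and all real y: Q_{(w,x,0)}(D;y) = Σ_{F ∈ 𝓕} w^{|E|−|F|} x^{|F|} (1 + (w/x)y)^{i(F)} (1 + (x/w)y)^{j(F)}. -/
open Finset

open Classical in
/-- The number of points of `A` that are active with respect to `F` and
`F`-orientable. -/
noncomputable def numActOr {α : Type*} [LinearOrder α] (𝓕 : Finset (Finset α))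
    (F A : Finset α) : ℕ :=
  (A.filter fun a => ActiveWrt 𝓕 F a ∧ ¬ FNonorientable 𝓕 F a).card

/-- `dmin 𝓕 B` is the minimum cardinality of `F Δ B` over feasible `F`. -/
noncomputable def dmin {α : Type*} [DecidableEq α] (𝓕 : Finset (Finset α))
    (B : Finset α) : ℕ :=
  sInf {n | ∃ F ∈ 𝓕, (symmDiff F B).card = n}

/-- The transition polynomial `Q_{(w,x,0)}(D;y)`, as a real-valued function. -/
noncomputable def transQ {α : Type*} [DecidableEq α] (E : Finset α)
    (𝓕 : Finset (Finset α)) (w x y : ℝ) : ℝ :=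
  ∑ B ∈ E.powerset, w ^ (E.card - B.card) * x ^ B.card * y ^ dmin 𝓕 B

section Helpers

variable {α : Type*}

theorem dmin_le' [DecidableEq α] {𝓕 : Finset (Finset α)} {F : Finset α} (hF : F ∈ 𝓕)
    (B : Finset α) : dmin 𝓕 B ≤ (symmDiff F B).card :=
  Nat.sInf_le ⟨F, hF, rfl⟩

theorem dmin_att [DecidableEq α] {𝓕 : Finset (Finset α)} (h : 𝓕.Nonempty)
    (B : Finset α) : ∃ F ∈ 𝓕, (symmDiff F B).card = dmin 𝓕 B := by
  obtain ⟨F, hF⟩ := h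
  exact Nat.sInf_mem (s := {n | ∃ F ∈ 𝓕, (symmDiff F B).card = n}) ⟨_, F, hF, rfl⟩

theorem dmin_filter [DecidableEq α] {𝓕 : Finset (Finset α)} (hex : SymExch 𝓕) (e : α)
    (C : Finset α) (𝓖 : Finset (Finset α)) (hG : ∀ F, F ∈ 𝓖 ↔ F ∈ 𝓕 ∧ (e ∈ F ↔ e ∈ C))
    (h : 𝓖.Nonempty) : dmin 𝓕 C = dmin 𝓖 C := by
  have hne : 𝓕.Nonempty := by
    obtain ⟨F, hF⟩ := h
    exact ⟨F, ((hG F).1 hF).1⟩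
  apply le_antisymm
  · obtain ⟨F, hF, h1⟩ := dmin_att h C
    rw [← h1]
    exact dmin_le' ((hG F).1 hF).1 C
  · obtain ⟨F, hF, h1⟩ := dmin_att hne C
    rw [← h1]
    by_cases he : e ∈ F ↔ e ∈ C
    · exact dmin_le' ((hG F).2 ⟨hF, he⟩) C
    · obtain ⟨G, hGm⟩ := h
      obtain ⟨hG1, hG2⟩ := (hG G).1 hGm
      obtain ⟨b, hb, hb2⟩ := hex F hF G hG1 e (by simp only [mem_symmDiff]; tauto)
      by_cases hbe : b = e
      · subst hbe
        refine (dmin_le' ((hG (symmDiff F {b, b})).2 ⟨hb2, ?_⟩) C).trans ?_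
        · simp only [mem_symmDiff, mem_insert, mem_singleton]; tauto
        · apply card_le_card
          intro z
          by_cases hz : z = b
          · subst hz; simp only [mem_symmDiff, mem_insert, mem_singleton]; tauto
          · simp only [mem_symmDiff, mem_insert, mem_singleton, hz]; tauto
      · refine (dmin_le' ((hG (symmDiff F {e, b})).2 ⟨hb2, ?_⟩) C).trans ?_
        · simp only [mem_symmDiff, mem_insert, mem_singleton]; tauto
        · have hs : symmDiff (symmDiff F {e, b}) C ⊆ insert b ((symmDiff F C).erase e) := by
            intro z
            by_cases hz : z = e
            · subst hz; simp only [mem_symmDiff, mem_insert, mem_singleton]; tauto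
            · by_cases hz2 : z = b
              · subst hz2; simp
              · simp only [mem_symmDiff, mem_insert, mem_singleton, mem_erase, hz, hz2]; tauto
          refine (card_le_card hs).trans ((card_insert_le _ _).trans ?_)
          have hm : e ∈ symmDiff F C := by simp only [mem_symmDiff]; tauto
          rw [card_erase_add_one hm]

theorem dmin_succ [DecidableEq α] {𝓕 : Finset (Finset α)} (hne : 𝓕.Nonempty) (e : α)
    (C C' : Finset α) (hC : ∀ z, z ≠ e → (z ∈ C ↔ z ∈ C'))
    (h : ∀ F ∈ 𝓕, ¬ (e ∈ F ↔ e ∈ C)) (h' : ∀ F ∈ 𝓕, (e ∈ F ↔ e ∈ C')) :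
    dmin 𝓕 C = dmin 𝓕 C' + 1 := by
  have key : ∀ F ∈ 𝓕, (symmDiff F C).card = (symmDiff F C').card + 1 := by
    intro F hF
    have h1 := h F hF
    have h2 := h' F hF
    have : symmDiff F C = insert e (symmDiff F C') := by
      ext z
      by_cases hz : z = e
      · subst hz; simp only [mem_symmDiff, mem_insert]; tauto
      · have := hC z hz
        simp only [mem_symmDiff, mem_insert, hz, this]; tauto
    rw [this, card_insert_of_notMem]
    simp only [mem_symmDiff]; tauto
  apply le_antisymm
  · obtain ⟨F, hF, h1⟩ := dmin_att hne C'
    rw [← h1, ← key F hF]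
    exact dmin_le' hF C
  · obtain ⟨F, hF, h1⟩ := dmin_att hne C
    rw [← h1, key F hF]
    exact Nat.succ_le_succ (dmin_le' hF C')

/-- active and orientable -/
def AO [LinearOrder α] (𝓕 : Finset (Finset α)) (F : Finset α) (a : α) : Prop :=
  ActiveWrt 𝓕 F a ∧ ¬ FNonorientable 𝓕 F a

theorem AO_congr [LinearOrder α] {𝓕 𝓖 : Finset (Finset α)} {F : Finset α} {a : α}
    (h : ∀ b, b ≤ a → (symmDiff F {b, a} ∈ 𝓕 ↔ symmDiff F {b, a} ∈ 𝓖))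
    (h' : ∀ b, b ≤ a → (symmDiff F {b} ∈ 𝓕 ↔ symmDiff F {b} ∈ 𝓖)) :
    AO 𝓕 F a ↔ AO 𝓖 F a := by
  unfold AO ActiveWrt FInterlaced FNonorientable
  rw [h' a le_rfl]
  refine and_congr_left fun _ => forall_congr' fun b => forall_congr' fun hb => ?_
  rw [h b hb.le, h' b hb.le]

theorem AO_filter [LinearOrder α] {𝓕 𝓖 : Finset (Finset α)} {F : Finset α} {a e : α}
    (hae : a < e) (hG : ∀ X, X ∈ 𝓖 ↔ X ∈ 𝓕 ∧ (e ∈ X ↔ e ∈ F)) :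
    AO 𝓕 F a ↔ AO 𝓖 F a := by
  apply AO_congr
  · intro b hb
    have h1 : e ≠ a := hae.ne'
    have h2 : e ≠ b := (hb.trans_lt hae).ne'
    rw [hG]
    simp [mem_symmDiff, h1, h2]
  · intro b hb
    have h2 : e ≠ b := (hb.trans_lt hae).ne'
    rw [hG]
    simp [mem_symmDiff, h2]

theorem not_AO [LinearOrder α] {𝓕 : Finset (Finset α)} (hex : SymExch 𝓕) {F G : Finset α} {e : α}
    (hF : F ∈ 𝓕) (hG : G ∈ 𝓕) (hFG : ¬ (e ∈ F ↔ e ∈ G))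
    (hmax : ∀ b ∈ symmDiff F G, b ≤ e) : ¬ AO 𝓕 F e := by
  rintro ⟨h1, h2⟩
  obtain ⟨b, hb, hb2⟩ := hex F hF G hG e (by simp only [mem_symmDiff]; tauto)
  have hbe : b ≠ e := by
    rintro rfl
    apply h2
    simpa [FNonorientable] using hb2
  refine h1 b (lt_of_le_of_ne (hmax b hb) hbe) ⟨hbe, Or.inl ⟨fun h => h2 h.2, ?_⟩⟩
  rwa [Finset.pair_comm]

theorem AO_const [LinearOrder α] {𝓕 : Finset (Finset α)} {F : Finset α} {e : α}
    (h : ∀ G ∈ 𝓕, (e ∈ G ↔ e ∈ F)) : AO 𝓕 F e := by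
  have h2 : ¬ FNonorientable 𝓕 F e := by
    intro h1
    have := h _ h1
    simp only [mem_symmDiff, mem_singleton] at this
    tauto
  refine ⟨fun b hb => ?_, h2⟩
  rintro ⟨_, h1 | h1⟩
  · have := h _ h1.2
    simp only [mem_symmDiff, mem_insert, mem_singleton] at this
    tauto
  · exact h2 h1.2.1

open Classical in
/-- local factor -/
noncomputable def phi [LinearOrder α] (w x y : ℝ) (𝓕 : Finset (Finset α)) (F : Finset α)
    (a : α) : ℝ :=
  if a ∈ F then (if AO 𝓕 F a then x + w * y else x) else (if AO 𝓕 F a then w + x * y else w)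

theorem SymExch_filter [DecidableEq α] {𝓕 : Finset (Finset α)} (hex : SymExch 𝓕) (e : α)
    (P : Prop) (𝓖 : Finset (Finset α)) (hG : ∀ X, X ∈ 𝓖 ↔ X ∈ 𝓕 ∧ (e ∈ X ↔ P)) :
    SymExch 𝓖 := by
  intro X hX Y hY a ha
  obtain ⟨hX1, hX2⟩ := (hG X).1 hX
  obtain ⟨hY1, hY2⟩ := (hG Y).1 hY
  obtain ⟨b, hb, hb2⟩ := hex X hX1 Y hY1 a ha
  refine ⟨b, hb, (hG _).2 ⟨hb2, ?_⟩⟩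
  have hne : ∀ c ∈ symmDiff X Y, e ≠ c := by
    rintro c hc rfl
    simp only [mem_symmDiff] at hc
    tauto
  have h1 := hne a ha
  have h2 := hne b hb
  simp [mem_symmDiff, h1, h2, hX2]

theorem main_ind [LinearOrder α] (w x y : ℝ) (E : Finset α) :
    ∀ (S : Finset α) (𝓕 : Finset (Finset α)), 𝓕.Nonempty → SymExch 𝓕 →
      (∀ F ∈ 𝓕, S ⊆ F ∧ F ⊆ S ∪ E) → Disjoint S E →
      ∑ B ∈ E.powerset, (∏ a ∈ E, if a ∈ B then x else w) * y ^ dmin 𝓕 (B ∪ S) =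
        ∑ F ∈ 𝓕, ∏ a ∈ E, phi w x y 𝓕 F a := by
  induction E using Finset.induction_on_max with
  | empty =>
    intro S 𝓕 hne _ hS _
    have : 𝓕 = {S} := by
      rw [Finset.eq_singleton_iff_nonempty_unique_mem]
      refine ⟨hne, fun F hF => ?_⟩
      have := hS F hF
      rw [union_empty] at this
      exact subset_antisymm this.2 this.1
    subst this
    have h0 : dmin {S} S = 0 := by
      have := dmin_le' (mem_singleton_self S) S
      simpa using this
    simp [h0]
  | insert e s hmax ih =>
    intro S 𝓕 hne hex hS hdis
    have hes : e ∉ s := fun h => lt_irrefl _ (hmax e h)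
    have heS : e ∉ S := fun h => (Finset.disjoint_left.1 hdis h) (mem_insert_self _ _)
    have hdis0 : Disjoint S s := hdis.mono_right (subset_insert _ _)
    have hdis1 : Disjoint (insert e S) s := by
      rw [disjoint_insert_left]; exact ⟨hes, hdis0⟩
    -- left side
    have hL : ∑ B ∈ (insert e s).powerset,
          (∏ a ∈ insert e s, if a ∈ B then x else w) * y ^ dmin 𝓕 (B ∪ S) =
        w * ∑ B ∈ s.powerset, (∏ a ∈ s, if a ∈ B then x else w) * y ^ dmin 𝓕 (B ∪ S) +
        x * ∑ B ∈ s.powerset, (∏ a ∈ s, if a ∈ B then x else w) *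
          y ^ dmin 𝓕 (B ∪ insert e S) := by
      rw [sum_powerset_insert hes, mul_sum, mul_sum]
      congr 1
      · refine sum_congr rfl fun B hB => ?_
        have : e ∉ B := fun h => hes (mem_powerset.1 hB h)
        rw [prod_insert hes, if_neg this, mul_assoc]
      · refine sum_congr rfl fun B hB => ?_
        rw [prod_insert hes, if_pos (mem_insert_self _ _), mul_assoc, insert_union, union_insert]
        congr 2
        refine prod_congr rfl fun a ha => ?_
        have : a ≠ e := (hmax a ha).ne
        simp [this]
    rw [hL]
    simp_rw [prod_insert hes]
    have hcase0 : ∀ 𝓖 ⊆ 𝓕, (∀ F ∈ 𝓖, e ∉ F) → ∀ F ∈ 𝓖, S ⊆ F ∧ F ⊆ S ∪ s := by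
      intro 𝓖 h1 h2 F hF
      obtain ⟨h3, h4⟩ := hS F (h1 hF)
      refine ⟨h3, fun z hz => ?_⟩
      have h5 := h4 hz
      have : z ≠ e := by rintro rfl; exact h2 F hF hz
      simpa [this] using h5
    have hcase1 : ∀ 𝓖 ⊆ 𝓕, (∀ F ∈ 𝓖, e ∈ F) →
        ∀ F ∈ 𝓖, insert e S ⊆ F ∧ F ⊆ insert e S ∪ s := by
      intro 𝓖 h1 h2 F hF
      obtain ⟨h3, h4⟩ := hS F (h1 hF)
      refine ⟨insert_subset (h2 F hF) h3, fun z hz => ?_⟩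
      have h5 := h4 hz
      simp only [mem_union, mem_insert] at h5 ⊢
      tauto
    have hnB : ∀ B ∈ s.powerset, e ∉ B ∪ S := by
      intro B hB h
      rcases mem_union.1 h with h | h
      · exact hes (mem_powerset.1 hB h)
      · exact heS h
    by_cases h1 : ∃ F ∈ 𝓕, e ∈ F
    · by_cases h0 : ∃ F ∈ 𝓕, e ∉ F
      · obtain ⟨F1, hF1, he1⟩ := h1
        obtain ⟨F0, hF0, he0⟩ := h0
        set 𝓖1 := 𝓕.filter (fun F => e ∈ F) with h𝓖1
        set 𝓖0 := 𝓕.filter (fun F => ¬ e ∈ F) with h𝓖0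
        have hm1 : ∀ X, X ∈ 𝓖1 ↔ X ∈ 𝓕 ∧ (e ∈ X ↔ True) := by simp [h𝓖1]
        have hm0 : ∀ X, X ∈ 𝓖0 ↔ X ∈ 𝓕 ∧ (e ∈ X ↔ False) := by simp [h𝓖0]
        have hn1 : 𝓖1.Nonempty := ⟨F1, by simp [h𝓖1, hF1, he1]⟩
        have hn0 : 𝓖0.Nonempty := ⟨F0, by simp [h𝓖0, hF0, he0]⟩
        have i1 := ih (insert e S) 𝓖1 hn1 (SymExch_filter hex e _ _ hm1)
          (hcase1 _ (filter_subset _ _) (fun F hF => (mem_filter.1 hF).2)) hdis1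
        have i0 := ih S 𝓖0 hn0 (SymExch_filter hex e _ _ hm0)
          (hcase0 _ (filter_subset _ _) (fun F hF => (mem_filter.1 hF).2)) hdis0
        have hle : ∀ F ∈ 𝓕, ∀ G ∈ 𝓕, ∀ b ∈ symmDiff F G, b ≤ e := by
          intro F hF G hG b hb
          have a1 := (hS F hF).1
          have a2 := (hS F hF).2
          have a3 := (hS G hG).1
          have a4 := (hS G hG).2
          have : b ∈ insert e s := by
            have q1 := @a1 b
            have q2 := @a2 b
            have q3 := @a3 b
            have q4 := @a4 b
            simp only [mem_union, mem_symmDiff] at *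
            tauto
          rcases mem_insert.1 this with h | h
          · exact h.le
          · exact (hmax b h).le
        rw [← sum_filter_add_sum_filter_not 𝓕 (fun F => e ∈ F), ← h𝓖1, ← h𝓖0, add_comm]
        congr 1
        · skip
          have : ∀ F ∈ 𝓖1, phi w x y 𝓕 F e * ∏ a ∈ s, phi w x y 𝓕 F a
              = x * ∏ a ∈ s, phi w x y 𝓖1 F a := by
            intro F hF
            obtain ⟨hF', heF⟩ := mem_filter.1 hF
            have hn : ¬ AO 𝓕 F e := not_AO hex hF' hF0 (by tauto) (hle F hF' F0 hF0)
            congr 1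
            · simp [phi, heF, hn]
            · refine prod_congr rfl fun a ha => ?_
              have := AO_filter (F := F) (hmax a ha) (𝓕 := 𝓕) (𝓖 := 𝓖1)
                (by intro X; rw [hm1]; tauto)
              by_cases hq : AO 𝓕 F a
              · simp only [phi, hq, this.1 hq]
              · simp only [phi, hq, mt this.2 hq]
          rw [sum_congr rfl this, ← mul_sum, ← i1]
          congr 1
          refine sum_congr rfl fun B hB => ?_
          rw [dmin_filter hex e (B ∪ insert e S) 𝓖1 (by intro X; rw [hm1]; simp) hn1]
        · have : ∀ F ∈ 𝓖0, phi w x y 𝓕 F e * ∏ a ∈ s, phi w x y 𝓕 F a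
              = w * ∏ a ∈ s, phi w x y 𝓖0 F a := by
            intro F hF
            obtain ⟨hF', heF⟩ := mem_filter.1 hF
            have hn : ¬ AO 𝓕 F e := not_AO hex hF' hF1 (by tauto) (hle F hF' F1 hF1)
            congr 1
            · simp [phi, heF, hn]
            · refine prod_congr rfl fun a ha => ?_
              have := AO_filter (F := F) (hmax a ha) (𝓕 := 𝓕) (𝓖 := 𝓖0)
                (by intro X; rw [hm0]; tauto)
              by_cases hq : AO 𝓕 F a
              · simp only [phi, hq, this.1 hq]
              · simp only [phi, hq, mt this.2 hq]
          rw [sum_congr rfl this, ← mul_sum, ← i0]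
          congr 1
          refine sum_congr rfl fun B hB => ?_
          have := hnB B hB
          rw [dmin_filter hex e (B ∪ S) 𝓖0 (by intro X; rw [hm0]; tauto) hn0]
      · push Not at h0
        have i1 := ih (insert e S) 𝓕 hne hex (hcase1 _ subset_rfl h0) hdis1
        have hph : ∀ F ∈ 𝓕, phi w x y 𝓕 F e * ∏ a ∈ s, phi w x y 𝓕 F a
              = (x + w * y) * ∏ a ∈ s, phi w x y 𝓕 F a := by
          intro F hF
          have hA : AO 𝓕 F e := AO_const fun G hG => by simp [h0 G hG, h0 F hF]
          simp [phi, hA, h0 F hF]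
        rw [sum_congr rfl hph, ← mul_sum, ← i1, add_mul, add_comm, mul_assoc w y]
        congr 2
        rw [mul_sum]
        refine sum_congr rfl fun B hB => ?_
        have hB' := hnB B hB
        rw [dmin_succ hne e (B ∪ S) (B ∪ insert e S) (by intro z hz; simp [hz])
          (by intro F hF; have := h0 F hF; tauto) (by intro F hF; simp [h0 F hF]), pow_succ]
        ring
    · push Not at h1
      have i0 := ih S 𝓕 hne hex (hcase0 _ subset_rfl h1) hdis0
      have hph : ∀ F ∈ 𝓕, phi w x y 𝓕 F e * ∏ a ∈ s, phi w x y 𝓕 F a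
            = (w + x * y) * ∏ a ∈ s, phi w x y 𝓕 F a := by
        intro F hF
        have hA : AO 𝓕 F e := AO_const fun G hG => by simp [h1 G hG, h1 F hF]
        simp [phi, hA, h1 F hF]
      rw [sum_congr rfl hph, ← mul_sum, ← i0, add_mul, mul_assoc x y]
      congr 2
      rw [mul_sum]
      refine sum_congr rfl fun B hB => ?_
      have hB' := hnB B hB
      rw [dmin_succ hne e (B ∪ insert e S) (B ∪ S) (by intro z hz; simp [hz])
        (by intro F hF; have := h1 F hF; simp [this])
        (by intro F hF; have := h1 F hF; tauto), pow_succ]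
      ring

end Helpers

/-- The activities-based feasible-set expansion of the transition
polynomial `Q_{(w,x,0)}(D;y)`. -/
theorem transQ_feasibleSet_expansion {α : Type*} [LinearOrder α]
    (E : Finset α) (𝓕 : Finset (Finset α))
    (hne : 𝓕.Nonempty) (hsub : ∀ F ∈ 𝓕, F ⊆ E) (hex : SymExch 𝓕) :
    ∀ w x y : ℝ, w ≠ 0 → x ≠ 0 →
      transQ E 𝓕 w x y =
        ∑ F ∈ 𝓕, w ^ (E.card - F.card) * x ^ F.card *
          (1 + (w / x) * y) ^ numActOr 𝓕 F F *
          (1 + (x / w) * y) ^ numActOr 𝓕 F (E \ F) := by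
  intro w x y hw hx
  classical
  have hwt : ∀ B ∈ E.powerset, w ^ (E.card - B.card) * x ^ B.card =
      ∏ a ∈ E, if a ∈ B then x else w := by
    intro B hB
    have hB := mem_powerset.1 hB
    rw [prod_ite, prod_const, prod_const, filter_mem_eq_inter, inter_eq_right.2 hB,
      ← sdiff_eq_filter, card_sdiff_of_subset hB, mul_comm]
  have h := main_ind w x y E ∅ 𝓕 hne hex (fun F hF => ⟨empty_subset _, by simpa using hsub F hF⟩)
    (disjoint_empty_left _)
  unfold transQ
  have hl : ∑ B ∈ E.powerset, w ^ (E.card - B.card) * x ^ B.card * y ^ dmin 𝓕 B =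
      ∑ B ∈ E.powerset, (∏ a ∈ E, if a ∈ B then x else w) * y ^ dmin 𝓕 (B ∪ ∅) := by
    refine sum_congr rfl fun B hB => ?_
    rw [hwt B hB, union_empty]
  rw [hl, h]
  refine sum_congr rfl fun F hF => ?_
  have hFE := hsub F hF
  have e1 : ∀ A : Finset α, ∀ c : ℝ, c ^ numActOr 𝓕 F A =
      ∏ a ∈ A, if AO 𝓕 F a then c else 1 := by
    intro A c
    rw [prod_ite, prod_const, prod_const, one_pow, mul_one]
    unfold numActOr AO
    congr!
  rw [hwt F (mem_powerset.2 hFE), e1, e1, mul_assoc, mul_comm (∏ a ∈ F, _), 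
    ← prod_sdiff hFE, ← prod_sdiff (f := fun a => if a ∈ F then x else w) hFE,
    mul_mul_mul_comm, ← prod_mul_distrib, ← prod_mul_distrib]
  congr 1
  · refine prod_congr rfl fun a ha => ?_
    have : a ∉ F := (mem_sdiff.1 ha).2
    by_cases hA : AO 𝓕 F a
    · simp only [phi, this, hA, if_true, if_false]; field_simp
    · simp [phi, this, hA]
  · refine prod_congr rfl fun a ha => ?_
    by_cases hA : AO 𝓕 F a
    · simp only [phi, ha, hA, if_true]; field_simp
    · simp [phi, ha, hA]
end

section
/- Let D = (E, 𝓕) be a delta-matroid and let < be any total order on E. Let r_max(E) and r_min(E) be the maximum and minimum cardinalities of feasible sets of D. Then for all real numbers x > 1 and y > 1 (with half-integer exponents interpreted as real powers), the two-variable Bollobás–Riordan polynomial satisfies: R̃(D;x,y) = Σ_{F ∈ 𝓕} (x−1)^{(r_max(E) − |F|)/2} (y−1)^{(|F| − r_min(E))/2} x^{i(F)} y^{j(F)}. -/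
open Finset

/-- Deletion of a point, on the level of collections of feasible sets:
if `a` is not a coloop, keep the feasible sets avoiding `a`; if `a` is a
coloop, `D ∖ a := D / a`, i.e. remove `a` from every feasible set. -/
def delOp {α : Type*} [DecidableEq α] (𝓕 : Finset (Finset α)) (a : α) :
    Finset (Finset α) :=
  if ∀ F ∈ 𝓕, a ∈ F then 𝓕.image (fun F => F.erase a)
  else 𝓕.filter (fun F => a ∉ F)

/-- The feasible sets of the restriction `D|A`, obtained by deleting each
point of `E ∖ A` (the result is independent of the order chosen). -/
noncomputable def restrictOp {α : Type*} [DecidableEq α] (E : Finset α)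
    (𝓕 : Finset (Finset α)) (A : Finset α) : Finset (Finset α) :=
  (E \ A).toList.foldl delOp 𝓕

/-- The maximum cardinality of a feasible set. -/
def rmaxN {α : Type*} (𝓕 : Finset (Finset α)) : ℕ :=
  𝓕.sup Finset.card

/-- The minimum cardinality of a feasible set. -/
noncomputable def rminN {α : Type*} (𝓕 : Finset (Finset α)) : ℕ :=
  sInf {n | ∃ F ∈ 𝓕, F.card = n}

/-- `σ_D(A) = (r_max(D|A) + r_min(D|A))/2`, as a real number. -/
noncomputable def sigmaD {α : Type*} [DecidableEq α] (E : Finset α)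
    (𝓕 : Finset (Finset α)) (A : Finset α) : ℝ :=
  ((rmaxN (restrictOp E 𝓕 A) : ℝ) + (rminN (restrictOp E 𝓕 A) : ℝ)) / 2

/-- The two-variable Bollobás–Riordan polynomial of a delta-matroid, for
`x, y > 1`, with (possibly half-integer) exponents interpreted as real
powers. -/
noncomputable def brQ {α : Type*} [DecidableEq α] (E : Finset α)
    (𝓕 : Finset (Finset α)) (x y : ℝ) : ℝ :=
  ∑ A ∈ E.powerset,
    (x - 1) ^ (sigmaD E 𝓕 E - sigmaD E 𝓕 A) *
      (y - 1) ^ ((A.card : ℝ) - sigmaD E 𝓕 A)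


noncomputable def dst {α : Type*} [DecidableEq α] (𝓕 : Finset (Finset α)) (A : Finset α) : ℕ :=
  sInf {n | ∃ F ∈ 𝓕, (symmDiff F A).card = n}

def contr {α : Type*} [DecidableEq α] (𝓕 : Finset (Finset α)) (a : α) : Finset (Finset α) :=
  (𝓕.filter (fun F => a ∈ F)).image (fun F => F.erase a)

section helpers
variable {α : Type*} [DecidableEq α] {𝓕 𝓖 : Finset (Finset α)} {a : α} {A F : Finset α}

theorem dst_exists (h : 𝓕.Nonempty) (A : Finset α) : ∃ F ∈ 𝓕, (symmDiff F A).card = dst 𝓕 A := by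
  have : {n | ∃ F ∈ 𝓕, (symmDiff F A).card = n}.Nonempty := by
    obtain ⟨F, hF⟩ := h
    exact ⟨_, F, hF, rfl⟩
  exact Nat.sInf_mem this

theorem dst_le (hF : F ∈ 𝓕) : dst 𝓕 A ≤ (symmDiff F A).card := Nat.sInf_le ⟨F, hF, rfl⟩

theorem mem_contr : F ∈ contr 𝓕 a ↔ a ∉ F ∧ insert a F ∈ 𝓕 := by
  simp only [contr, mem_image, mem_filter]
  constructor
  · rintro ⟨G, ⟨h1, h2⟩, rfl⟩
    simp [h1, insert_erase h2]
  · rintro ⟨h1, h2⟩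
    exact ⟨_, ⟨h2, mem_insert_self _ _⟩, erase_insert h1⟩

theorem sd_insert (ha : a ∉ F) (hA : a ∉ A) :
    symmDiff (insert a F) A = insert a (symmDiff F A) := by
  ext z; simp only [mem_symmDiff, mem_insert]; grind

theorem sd_insert_insert (ha : a ∉ F) (hA : a ∉ A) :
    symmDiff (insert a F) (insert a A) = symmDiff F A := by
  ext z; simp only [mem_symmDiff, mem_insert]; grind

theorem sd_insert_right (ha : a ∉ F) (hA : a ∉ A) :
    symmDiff F (insert a A) = insert a (symmDiff F A) := by
  ext z; simp only [mem_symmDiff, mem_insert]; grind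

theorem not_mem_sd (ha : a ∉ F) (hA : a ∉ A) : a ∉ symmDiff F A := by
  simp [mem_symmDiff, ha, hA]

/-- The exchange step: an optimal set can be taken to agree with `A` at `a`. -/
theorem exch_near (hex : SymExch 𝓕) {X Y : Finset α} (hX : X ∈ 𝓕) (hY : Y ∈ 𝓕)
    (haX : a ∈ symmDiff X A) (haY : a ∉ symmDiff Y A) :
    ∃ Z ∈ 𝓕, a ∉ symmDiff Z A ∧ (symmDiff Z A).card ≤ (symmDiff X A).card := by
  have haXY : a ∈ symmDiff X Y := by
    simp only [mem_symmDiff] at *; tauto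
  obtain ⟨b, hb, hZ⟩ := hex X hX Y hY a haXY
  refine ⟨_, hZ, ?_, ?_⟩
  · simp only [mem_symmDiff, mem_insert, mem_singleton] at *; tauto
  · have : symmDiff (symmDiff X {a, b}) A ⊆ insert b ((symmDiff X A).erase a) := by
      intro z
      simp only [mem_symmDiff, mem_insert, mem_singleton, mem_erase] at *; grind
    refine (card_le_card this).trans ((card_insert_le _ _).trans ?_)
    rw [card_erase_add_one haX]

theorem exch_filter (hex : SymExch 𝓕) : SymExch (𝓕.filter (fun F => a ∉ F)) := by
  intro X hX Y hY z hz
  rw [mem_filter] at hX hY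
  obtain ⟨b, hb, h⟩ := hex X hX.1 Y hY.1 z hz
  refine ⟨b, hb, mem_filter.2 ⟨h, ?_⟩⟩
  obtain ⟨_, h1⟩ := hX
  obtain ⟨_, h2⟩ := hY
  simp only [mem_symmDiff, mem_insert, mem_singleton] at *
  grind

theorem exch_contr (hex : SymExch 𝓕) : SymExch (contr 𝓕 a) := by
  intro X hX Y hY z hz
  rw [mem_contr] at hX hY
  obtain ⟨b, hb, h⟩ := hex _ hX.2 _ hY.2 z (by rwa [sd_insert_insert hX.1 hY.1])
  rw [sd_insert_insert hX.1 hY.1] at hb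
  have hna := not_mem_sd hX.1 hY.1
  have : a ∉ ({z, b} : Finset α) := by
    simp only [mem_insert, mem_singleton]; grind
  refine ⟨b, hb, mem_contr.2 ⟨not_mem_sd hX.1 this, ?_⟩⟩
  rwa [← sd_insert hX.1 this]

theorem dst_filter (hex : SymExch 𝓕) (hne : ∃ F ∈ 𝓕, a ∉ F) (hA : a ∉ A) :
    dst (𝓕.filter (fun F => a ∉ F)) A = dst 𝓕 A := by
  obtain ⟨Y, hY, haY⟩ := hne
  apply le_antisymm
  · obtain ⟨X, hX, h⟩ := dst_exists ⟨Y, hY⟩ A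
    rw [← h]
    by_cases hx : a ∈ X
    · obtain ⟨Z, hZ, h1, h2⟩ := exch_near (A := A) hex hX hY
        (by simp [mem_symmDiff, hx, hA]) (not_mem_sd haY hA)
      refine (dst_le (mem_filter.2 ⟨hZ, ?_⟩)).trans h2
      simp only [mem_symmDiff] at h1; tauto
    · exact dst_le (mem_filter.2 ⟨hX, hx⟩)
  · obtain ⟨X, hX, h⟩ := dst_exists (𝓕 := 𝓕.filter (fun F => a ∉ F)) ⟨Y, mem_filter.2 ⟨hY, haY⟩⟩ A
    rw [← h]
    exact dst_le (mem_filter.1 hX).1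

theorem dst_contr (hex : SymExch 𝓕) (hne : ∃ F ∈ 𝓕, a ∈ F) (hA : a ∉ A) :
    dst (contr 𝓕 a) A = dst 𝓕 (insert a A) := by
  obtain ⟨Y, hY, haY⟩ := hne
  have key : ∀ Z ∈ 𝓕, a ∈ Z → dst (contr 𝓕 a) A ≤ (symmDiff Z (insert a A)).card := by
    intro Z hZ haZ
    have h1 : Z.erase a ∈ contr 𝓕 a := mem_contr.2 ⟨by simp, by rwa [insert_erase haZ]⟩
    have := dst_le (A := A) h1
    rwa [← sd_insert_insert (by simp) hA, insert_erase haZ] at this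
  apply le_antisymm
  · obtain ⟨X, hX, h⟩ := dst_exists ⟨Y, hY⟩ (insert a A)
    rw [← h]
    by_cases hx : a ∈ X
    · exact key X hX hx
    · obtain ⟨Z, hZ, h1, h2⟩ := exch_near (A := insert a A) (a := a) hex hX hY
        (by simp [mem_symmDiff, hx]) (by simp [mem_symmDiff, haY])
      refine (key Z hZ ?_).trans h2
      simp only [mem_symmDiff, mem_insert] at h1; tauto
  · obtain ⟨X, hX, h⟩ := dst_exists (𝓕 := contr 𝓕 a)
      ⟨Y.erase a, mem_contr.2 ⟨by simp, by rwa [insert_erase haY]⟩⟩ A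
    rw [mem_contr] at hX
    rw [← h, ← sd_insert_insert hX.1 hA]
    exact dst_le hX.2

/-- Coloop. -/
theorem dst_coloop (hne : 𝓕.Nonempty) (hc : ∀ F ∈ 𝓕, a ∈ F) (hA : a ∉ A) :
    dst 𝓕 A = dst 𝓕 (insert a A) + 1 := by
  have key : ∀ X ∈ 𝓕, (symmDiff X A).card = (symmDiff X (insert a A)).card + 1 := by
    intro X hX
    have := sd_insert (F := X.erase a) (A := A) (by simp) hA
    rw [insert_erase (hc X hX)] at this
    have h2 := sd_insert_insert (F := X.erase a) (A := A) (by simp) hA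
    rw [insert_erase (hc X hX)] at h2
    rw [this, h2, card_insert_of_notMem (not_mem_sd (by simp) hA)]
  obtain ⟨X, hX, h⟩ := dst_exists hne A
  obtain ⟨Y, hY, h'⟩ := dst_exists hne (insert a A)
  have h1 := key X hX
  have h2 := key Y hY
  have h3 := dst_le (A := A) hY
  have h4 := dst_le (A := insert a A) hX
  omega

theorem dst_loop (hne : 𝓕.Nonempty) (hc : ∀ F ∈ 𝓕, a ∉ F) (hA : a ∉ A) :
    dst 𝓕 (insert a A) = dst 𝓕 A + 1 := by
  have key : ∀ X ∈ 𝓕, (symmDiff X (insert a A)).card = (symmDiff X A).card + 1 := by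
    intro X hX
    rw [sd_insert_right (hc X hX) hA, card_insert_of_notMem (not_mem_sd (hc X hX) hA)]
  obtain ⟨X, hX, h⟩ := dst_exists hne A
  obtain ⟨Y, hY, h'⟩ := dst_exists hne (insert a A)
  have h1 := key X hX
  have h2 := key Y hY
  have h3 := dst_le (A := A) hY
  have h4 := dst_le (A := insert a A) hX
  omega

theorem delOp_coloop (hc : ∀ F ∈ 𝓕, a ∈ F) : delOp 𝓕 a = contr 𝓕 a := by
  rw [delOp, if_pos hc, contr, filter_true_of_mem hc]

theorem delOp_not (hc : ¬ ∀ F ∈ 𝓕, a ∈ F) : delOp 𝓕 a = 𝓕.filter (fun F => a ∉ F) := by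
  rw [delOp, if_neg hc]

theorem delOp_prop (hne : 𝓕.Nonempty) (hex : SymExch 𝓕) (hA : a ∉ A) :
    (delOp 𝓕 a).Nonempty ∧ SymExch (delOp 𝓕 a) ∧
    (∀ G ∈ delOp 𝓕 a, a ∉ G ∧ ∃ F ∈ 𝓕, G ⊆ F) ∧
    dst (delOp 𝓕 a) A + dst 𝓕 ∅ = dst 𝓕 A + dst (delOp 𝓕 a) ∅ := by
  by_cases hc : ∀ F ∈ 𝓕, a ∈ F
  · obtain ⟨Y, hY⟩ := hne
    have haY := hc Y hY
    rw [delOp_coloop hc]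
    refine ⟨⟨Y.erase a, mem_contr.2 ⟨by simp, by rwa [insert_erase haY]⟩⟩, exch_contr hex, ?_, ?_⟩
    · intro G hG
      rw [mem_contr] at hG
      exact ⟨hG.1, _, hG.2, subset_insert _ _⟩
    · rw [dst_contr hex ⟨Y, hY, haY⟩ hA, dst_contr hex ⟨Y, hY, haY⟩ (notMem_empty a),
        dst_coloop ⟨Y, hY⟩ hc hA, dst_coloop ⟨Y, hY⟩ hc (notMem_empty a)]
      omega
  · rw [delOp_not hc]
    push Not at hc
    refine ⟨?_, exch_filter hex, ?_, ?_⟩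
    · obtain ⟨F, h1, h2⟩ := hc
      exact ⟨F, mem_filter.2 ⟨h1, h2⟩⟩
    · intro G hG
      rw [mem_filter] at hG
      exact ⟨hG.2, G, hG.1, Subset.refl _⟩
    · rw [dst_filter hex hc hA, dst_filter hex hc (notMem_empty a)]

theorem foldl_prop (A : Finset α) (L : List α) : ∀ 𝓕 : Finset (Finset α), 𝓕.Nonempty → SymExch 𝓕 →
    (∀ a ∈ L, a ∉ A) →
    (L.foldl delOp 𝓕).Nonempty ∧ 
    (∀ G ∈ L.foldl delOp 𝓕, (∀ a ∈ L, a ∉ G) ∧ ∃ F ∈ 𝓕, G ⊆ F) ∧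
    dst (L.foldl delOp 𝓕) A + dst 𝓕 ∅ = dst 𝓕 A + dst (L.foldl delOp 𝓕) ∅ := by
  induction L with
  | nil =>
    intro 𝓕 hne hex _
    refine ⟨hne, ?_, rfl⟩
    intro G hG
    exact ⟨by simp, G, hG, Subset.refl _⟩
  | cons a L ih =>
    intro 𝓕 hne hex hA
    obtain ⟨h1, h2, h3, h4⟩ := delOp_prop hne hex (hA a (by simp))
    obtain ⟨k1, k3, k4⟩ := ih _ h1 h2 (fun b hb => hA b (by simp [hb]))
    rw [List.foldl_cons]
    refine ⟨k1, ?_, by omega⟩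
    intro G hG
    obtain ⟨l1, F, l2, l3⟩ := k3 G hG
    obtain ⟨m1, F', m2, m3⟩ := h3 F l2
    refine ⟨?_, F', m2, l3.trans m3⟩
    intro b hb
    rcases List.mem_cons.1 hb with rfl | hb
    · exact fun h => m1 (l3 h)
    · exact l1 b hb

theorem dst_empty (𝓕 : Finset (Finset α)) : dst 𝓕 ∅ = rminN 𝓕 := by
  have : ∀ F : Finset α, symmDiff F ∅ = F := fun F => symmDiff_bot F
  simp only [dst, rminN, this]

theorem dst_full (hne : 𝓕.Nonempty) (h : ∀ F ∈ 𝓕, F ⊆ A) : dst 𝓕 A + rmaxN 𝓕 = A.card := by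
  have key : ∀ F ∈ 𝓕, (symmDiff F A).card + F.card = A.card := by
    intro F hF
    rw [symmDiff_of_le (h F hF)]
    exact card_sdiff_add_card_eq_card (h F hF)
  obtain ⟨X, hX, h1⟩ := dst_exists hne A
  obtain ⟨Y, hY, h2⟩ := exists_mem_eq_sup 𝓕 hne Finset.card
  have h3 := dst_le (A := A) hY
  have h4 : X.card ≤ 𝓕.sup card := le_sup (f := Finset.card) hX
  have := key X hX
  have := key Y hY
  unfold rmaxN
  omega

theorem sigma_eq {E : Finset α} (hne : 𝓕.Nonempty) (hsub : ∀ F ∈ 𝓕, F ⊆ E) (hex : SymExch 𝓕)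
    (A : Finset α) : 
    sigmaD E 𝓕 A = ((A.card : ℝ) - dst 𝓕 A + rminN 𝓕) / 2 := by
  obtain ⟨h1, h2, h3⟩ := foldl_prop A (E \ A).toList 𝓕 hne hex (by simp)
  have h4 := dst_full (A := A) h1 (by
    intro G hG z hz
    obtain ⟨k1, F, k2, k3⟩ := h2 G hG
    by_contra hzA
    exact k1 z (by simp [hzA, hsub F k2 (k3 hz)]) hz)
  rw [dst_empty, dst_empty] at h3
  unfold sigmaD restrictOp
  have : rmaxN ((E \ A).toList.foldl delOp 𝓕) + rminN ((E \ A).toList.foldl delOp 𝓕) + dst 𝓕 A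
    = A.card + rminN 𝓕 := by omega
  have h5 := congrArg (Nat.cast : ℕ → ℝ) this
  push_cast at h5
  linarith

end helpers

section act
variable {α : Type*} [LinearOrder α] {𝓕 : Finset (Finset α)} {e a : α} {F s : Finset α}

theorem act_max (hs : ∀ z ∈ s, z < e) (hsub : ∀ F ∈ 𝓕, F ⊆ insert e s)
    (hex : SymExch 𝓕) (hF : F ∈ 𝓕) :
    (ActiveWrt 𝓕 F e ∧ ¬ FNonorientable 𝓕 F e) ↔ ∀ Y ∈ 𝓕, (e ∈ Y ↔ e ∈ F) := by
  constructor
  · rintro ⟨h1, h2⟩ Y hY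
    by_contra hne
    obtain ⟨b, hb, h⟩ := hex F hF Y hY e (by rw [mem_symmDiff]; tauto)
    by_cases hbe : b = e
    · subst hbe
      apply h2
      simpa [FNonorientable] using h
    · have hbE : b ∈ insert e s := by
        rw [mem_symmDiff] at hb
        rcases hb with hb | hb
        · exact hsub F hF hb.1
        · exact hsub Y hY hb.1
      have hlt : b < e := hs b (mem_of_mem_insert_of_ne hbE hbe)
      refine h1 b hlt ⟨hbe, Or.inl ⟨fun h => h2 h.2, ?_⟩⟩
      rwa [pair_comm]
  · intro h
    have hno : ¬ FNonorientable 𝓕 F e := by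
      intro hn
      have := h _ hn
      simp [mem_symmDiff] at this
    refine ⟨?_, hno⟩
    rintro b hb ⟨hbe, h3 | h3⟩
    · have := h _ h3.2
      simp [mem_symmDiff] at this
    · exact hno h3.2.1

theorem act_congr {𝓖 : Finset (Finset α)} {G : Finset α}
    (h : ∀ P : Finset α, (∀ z ∈ P, z < e) → (symmDiff F P ∈ 𝓕 ↔ symmDiff G P ∈ 𝓖)) (ha : a < e) :
    (ActiveWrt 𝓕 F a ∧ ¬ FNonorientable 𝓕 F a) ↔ (ActiveWrt 𝓖 G a ∧ ¬ FNonorientable 𝓖 G a) := by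
  have hn : ∀ b, b < e → (FNonorientable 𝓕 F b ↔ FNonorientable 𝓖 G b) := by
    intro b hb
    exact h {b} (by simpa using hb)
  have hp : ∀ b, b < e → (symmDiff F {b, a} ∈ 𝓕 ↔ symmDiff G {b, a} ∈ 𝓖) := by
    intro b hb
    exact h {b, a} (by simpa using ⟨hb, ha⟩)
  have hA : ActiveWrt 𝓕 F a ↔ ActiveWrt 𝓖 G a := by
    unfold ActiveWrt FInterlaced
    refine forall_congr' fun b => forall_congr' fun hb => ?_
    rw [hn b (hb.trans ha), hn a ha, hp b (hb.trans ha)]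
  rw [hA, hn a ha]

theorem num_congr {𝓖 : Finset (Finset α)} {G A : Finset α}
    (h : ∀ P : Finset α, (∀ z ∈ P, z < e) → (symmDiff F P ∈ 𝓕 ↔ symmDiff G P ∈ 𝓖))
    (hA : ∀ z ∈ A, z < e) : numActOr 𝓕 F A = numActOr 𝓖 G A := by
  classical
  unfold numActOr
  congr 1
  apply filter_congr
  intro z hz
  exact act_congr h (hA z hz)

theorem num_insert {A : Finset α} (he : e ∉ A) : numActOr 𝓕 F (insert e A) =
    numActOr 𝓕 F A + (open Classical in if ActiveWrt 𝓕 F e ∧ ¬ FNonorientable 𝓕 F e then 1 else 0) := by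
  classical
  unfold numActOr
  rw [filter_insert]
  split_ifs with h
  · rw [card_insert_of_notMem (by simp [he])]
  · rfl

theorem congr_filter (he : e ∉ F) (P : Finset α) (hP : ∀ z ∈ P, z < e) :
    symmDiff F P ∈ 𝓕 ↔ symmDiff F P ∈ 𝓕.filter (fun F => e ∉ F) := by
  have : e ∉ P := fun h => lt_irrefl _ (hP e h)
  simp [not_mem_sd he this]

theorem congr_contr (he : e ∉ F) (P : Finset α) (hP : ∀ z ∈ P, z < e) :
    symmDiff (insert e F) P ∈ 𝓕 ↔ symmDiff F P ∈ contr 𝓕 e := by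
  have : e ∉ P := fun h => lt_irrefl _ (hP e h)
  simp [mem_contr, not_mem_sd he this, sd_insert he this]

theorem sum_split (g : Finset α → ℝ) (e : α) (𝓕 : Finset (Finset α)) : ∑ F ∈ 𝓕, g F =
    ∑ F ∈ 𝓕.filter (fun F => e ∉ F), g F + ∑ G ∈ contr 𝓕 e, g (insert e G) := by
  rw [← sum_filter_add_sum_filter_not 𝓕 (fun F => e ∉ F)]
  congr 1
  unfold contr
  rw [sum_image]
  · simp only [not_not]
    apply sum_congr rfl
    intro F hF
    rw [insert_erase (mem_filter.1 hF).2]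
  · intro X hX Y hY h
    simp only [coe_filter, Set.mem_ofPred_eq] at hX hY
    have h : X.erase e = Y.erase e := h
    rw [← insert_erase hX.2, h, insert_erase hY.2]

theorem main_poly (t w x y : ℝ) (hx : t * x = t + w) (hy : y = 1 + w * t) (E : Finset α) :
    ∀ 𝓕 : Finset (Finset α), 𝓕.Nonempty → (∀ F ∈ 𝓕, F ⊆ E) → SymExch 𝓕 →
    ∑ A ∈ E.powerset, w ^ dst 𝓕 A * t ^ A.card =
      ∑ F ∈ 𝓕, t ^ F.card * x ^ numActOr 𝓕 F F * y ^ numActOr 𝓕 F (E \ F) := by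
  induction E using Finset.induction_on_max with
  | empty =>
    intro 𝓕 hne hsub hex
    have h𝓕 : 𝓕 = {∅} := by
      apply eq_singleton_iff_nonempty_unique_mem.2 ⟨hne, fun F hF => ?_⟩
      exact subset_empty.1 (hsub F hF)
    have hd : dst 𝓕 ∅ = 0 := by
      have := dst_le (𝓕 := 𝓕) (F := ∅) (A := ∅) (by simp [h𝓕])
      simpa using this
    simp [hd]
    simp [h𝓕, numActOr]
  | insert e s hs ih =>
    intro 𝓕 hne hsub hex
    have hes : e ∉ s := fun h => lt_irrefl _ (hs e h)
    rw [sum_powerset_insert hes, sum_split _ e 𝓕]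
    -- powers on the two sides
    have hsub0 : ∀ F ∈ 𝓕.filter (fun F => e ∉ F), F ⊆ s := by
      intro F hF
      rw [mem_filter] at hF
      exact (subset_insert_iff_of_notMem hF.2).1 (hsub F hF.1)
    have hsub1 : ∀ F ∈ contr 𝓕 e, F ⊆ s := by
      intro F hF
      rw [mem_contr] at hF
      exact (subset_insert_iff_of_notMem hF.1).1 ((subset_insert _ _).trans (hsub _ hF.2))
    have hlt : ∀ F ⊆ s, ∀ z ∈ F, z < e := fun F hF z hz => hs z (hF hz)
    have nA : ∀ A ∈ s.powerset, e ∉ A := fun A hA h => hes (mem_powerset.1 hA h)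
    have i0 : ∀ F ∈ 𝓕.filter (fun F => e ∉ F),
        numActOr 𝓕 F F = numActOr (𝓕.filter (fun F => e ∉ F)) F F := by
      intro F hF
      exact num_congr (e := e) (congr_filter (mem_filter.1 hF).2) (hlt F (hsub0 F hF))
    have i1 : ∀ F ∈ contr 𝓕 e, numActOr 𝓕 (insert e F) (insert e s \ insert e F) =
        numActOr (contr 𝓕 e) F (s \ F) := by
      intro F hF
      have he := (mem_contr.1 hF).1
      have : insert e s \ insert e F = s \ F := by
        ext z; simp only [mem_sdiff, mem_insert]; grind
      rw [this]
      exact num_congr (e := e) (congr_contr he) (hlt _ sdiff_subset)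
    have j0 : ∀ F ∈ 𝓕.filter (fun F => e ∉ F), numActOr 𝓕 F (insert e s \ F) =
        numActOr (𝓕.filter (fun F => e ∉ F)) F (s \ F) +
          (open Classical in if ∀ Y ∈ 𝓕, e ∉ Y then 1 else 0) := by
      intro F hF
      have he := (mem_filter.1 hF).2
      rw [insert_sdiff_of_notMem _ he, num_insert (by simp [hes]),
        num_congr (e := e) (congr_filter he) (hlt (s \ F) sdiff_subset)]
      simp only [act_max hs hsub hex (mem_filter.1 hF).1, he, iff_false]
    have j1 : ∀ F ∈ contr 𝓕 e, numActOr 𝓕 (insert e F) (insert e F) =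
        numActOr (contr 𝓕 e) F F +
          (open Classical in if ∀ Y ∈ 𝓕, e ∈ Y then 1 else 0) := by
      intro F hF
      have he := (mem_contr.1 hF).1
      rw [num_insert he,
        num_congr (e := e) (congr_contr he) (hlt F (hsub1 F hF))]
      simp only [act_max hs hsub hex (mem_contr.1 hF).2, mem_insert_self, iff_true]
    have c1 : ∀ F ∈ contr 𝓕 e, (insert e F).card = F.card + 1 := fun F hF =>
      card_insert_of_notMem (mem_contr.1 hF).1
    have cA : ∀ A ∈ s.powerset, (insert e A).card = A.card + 1 := fun A hA =>
      card_insert_of_notMem (nA A hA)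
    rw [sum_congr (s₁ := 𝓕.filter (fun F => e ∉ F)) rfl (fun F hF => by rw [i0 F hF, j0 F hF]),
      sum_congr (s₁ := contr 𝓕 e) rfl (fun F hF => by rw [i1 F hF, j1 F hF, c1 F hF])]
    rw [sum_congr (s₁ := s.powerset) (f := fun A => w ^ dst 𝓕 (insert e A) * t ^ (insert e A).card)
      rfl (fun A hA => by rw [cA A hA])]
    by_cases hl : ∀ Y ∈ 𝓕, e ∉ Y
    · have hc : ¬ ∀ Y ∈ 𝓕, e ∈ Y := by
        obtain ⟨Y, hY⟩ := hne
        exact fun h => hl Y hY (h Y hY)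
      have e0 : 𝓕.filter (fun F => e ∉ F) = 𝓕 := filter_true_of_mem hl
      have e1 : contr 𝓕 e = ∅ := by
        apply eq_empty_of_forall_notMem
        intro F hF
        exact hl _ (mem_contr.1 hF).2 (mem_insert_self _ _)
      have := ih 𝓕 hne (by rwa [e0] at hsub0) hex
      rw [e1, sum_empty, add_zero, if_pos hl, e0]
      rw [sum_congr (s₁ := s.powerset) (f := fun A => w ^ dst 𝓕 (insert e A) * t ^ (A.card + 1))
        rfl (fun A hA => by rw [dst_loop hne hl (nA A hA)])]
      calc _ = y * ∑ A ∈ s.powerset, w ^ dst 𝓕 A * t ^ A.card := by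
            rw [← sum_add_distrib, mul_sum]
            refine sum_congr rfl fun A _ => ?_
            rw [hy]; ring
        _ = _ := by
            rw [this, mul_sum]
            refine sum_congr rfl fun A _ => ?_
            ring
    · by_cases hc : ∀ Y ∈ 𝓕, e ∈ Y
      · have e0 : 𝓕.filter (fun F => e ∉ F) = ∅ := by
          apply filter_false_of_mem
          simpa using hc
        push Not at hl
        have hne1 : (contr 𝓕 e).Nonempty := by
          obtain ⟨Y, hY, heY⟩ := hl
          exact ⟨Y.erase e, mem_contr.2 ⟨by simp, by rwa [insert_erase heY]⟩⟩
        have := ih _ hne1 hsub1 (exch_contr hex)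
        rw [e0, sum_empty, zero_add, if_pos hc]
        rw [sum_congr (s₁ := s.powerset) (f := fun A => w ^ dst 𝓕 A * t ^ A.card)
          rfl (fun A hA => by rw [dst_coloop hne hc (nA A hA), ← dst_contr hex hl (nA A hA)]),
          sum_congr (s₁ := s.powerset) (f := fun A => w ^ dst 𝓕 (insert e A) * t ^ (A.card + 1))
          rfl (fun A hA => by rw [← dst_contr hex hl (nA A hA)])]
        calc _ = (t * x) * ∑ A ∈ s.powerset, w ^ dst (contr 𝓕 e) A * t ^ A.card := by
              rw [← sum_add_distrib, mul_sum]
              refine sum_congr rfl fun A _ => ?_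
              rw [hx]; ring
          _ = _ := by
              rw [this, mul_sum]
              refine sum_congr rfl fun A _ => ?_
              ring
      · rw [if_neg hl, if_neg hc]
        push Not at hl hc
        have hne1 : (contr 𝓕 e).Nonempty := by
          obtain ⟨Y, hY, heY⟩ := hl
          exact ⟨Y.erase e, mem_contr.2 ⟨by simp, by rwa [insert_erase heY]⟩⟩
        have hne0 : (𝓕.filter (fun F => e ∉ F)).Nonempty := by
          obtain ⟨Y, hY, heY⟩ := hc
          exact ⟨Y, mem_filter.2 ⟨hY, heY⟩⟩
        have h1 := ih _ hne1 hsub1 (exch_contr hex)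
        have h0 := ih _ hne0 hsub0 (exch_filter hex)
        rw [sum_congr (s₁ := s.powerset) (f := fun A => w ^ dst 𝓕 A * t ^ A.card)
          rfl (fun A hA => by rw [← dst_filter hex hc (nA A hA)]),
          sum_congr (s₁ := s.powerset) (f := fun A => w ^ dst 𝓕 (insert e A) * t ^ (A.card + 1))
          rfl (fun A hA => by rw [← dst_contr hex hl (nA A hA)])]
        simp only [add_zero]
        congr 1
        calc _ = t * ∑ A ∈ s.powerset, w ^ dst (contr 𝓕 e) A * t ^ A.card := by
              rw [mul_sum]
              refine sum_congr rfl fun A _ => ?_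
              ring
          _ = _ := by
              rw [h1, mul_sum]
              refine sum_congr rfl fun A _ => ?_
              ring

end act

/-- The activities-based feasible-set expansion of the two-variable
Bollobás–Riordan polynomial of a delta-matroid. -/
theorem brQ_feasibleSet_expansion {α : Type*} [LinearOrder α]
    (E : Finset α) (𝓕 : Finset (Finset α))
    (hne : 𝓕.Nonempty) (hsub : ∀ F ∈ 𝓕, F ⊆ E) (hex : SymExch 𝓕) :
    ∀ x y : ℝ, 1 < x → 1 < y →
      brQ E 𝓕 x y =
        ∑ F ∈ 𝓕,
          (x - 1) ^ (((rmaxN 𝓕 : ℝ) - (F.card : ℝ)) / 2) *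
            (y - 1) ^ (((F.card : ℝ) - (rminN 𝓕 : ℝ)) / 2) *
            x ^ numActOr 𝓕 F F * y ^ numActOr 𝓕 F (E \ F) := by
  intro x y hx hy
  have hx0 : 0 < x - 1 := by linarith
  have hy0 : 0 < y - 1 := by linarith
  obtain ⟨u, hu0, hu⟩ : ∃ u : ℝ, 0 < u ∧ x - 1 = u ^ (2 : ℝ) :=
    ⟨√(x - 1), Real.sqrt_pos.2 hx0, by
      rw [Real.rpow_two, Real.sq_sqrt hx0.le]⟩
  obtain ⟨v, hv0, hv⟩ : ∃ v : ℝ, 0 < v ∧ y - 1 = v ^ (2 : ℝ) :=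
    ⟨√(y - 1), Real.sqrt_pos.2 hy0, by
      rw [Real.rpow_two, Real.sq_sqrt hy0.le]⟩
  have hmain := main_poly (v / u) (u * v) x y
    (by
      rw [Real.rpow_two] at hu
      have : x = 1 + u ^ 2 := by linarith
      rw [this]; field_simp)
    (by
      rw [Real.rpow_two] at hv
      have : y = 1 + v ^ 2 := by linarith
      rw [this]; field_simp) E 𝓕 hne hsub hex
  have hE : sigmaD E 𝓕 E = ((rmaxN 𝓕 : ℝ) + rminN 𝓕) / 2 := by
    simp [sigmaD, restrictOp]
  have key : ∀ d c : ℕ, (x - 1) ^ (((rmaxN 𝓕 : ℝ) - c + d) / 2) *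
      (y - 1) ^ (((c : ℝ) + d - rminN 𝓕) / 2) =
      (u ^ rmaxN 𝓕 / v ^ rminN 𝓕) * ((u * v) ^ d * (v / u) ^ c) := by
    intro d c
    rw [hu, hv, ← Real.rpow_mul hu0.le, ← Real.rpow_mul hv0.le, mul_div_cancel₀ _ (by norm_num),
      mul_div_cancel₀ _ (by norm_num), Real.rpow_add hu0, Real.rpow_sub hu0, Real.rpow_sub hv0,
      Real.rpow_add hv0]
    simp only [Real.rpow_natCast, mul_pow, div_pow]
    field_simp
  calc brQ E 𝓕 x y = (u ^ rmaxN 𝓕 / v ^ rminN 𝓕) *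
        ∑ A ∈ E.powerset, (u * v) ^ dst 𝓕 A * (v / u) ^ A.card := by
        rw [mul_sum]
        unfold brQ
        refine sum_congr rfl fun A _ => ?_
        rw [← key, hE, sigma_eq hne hsub hex A]
        congr 2 <;> ring
    _ = _ := by
        rw [hmain, mul_sum]
        refine sum_congr rfl fun F _ => ?_
        have := key 0 F.card
        simp only [Nat.cast_zero, add_zero, pow_zero, one_mul] at this
        rw [this]
        ring
end

section
/- Let M = (E, 𝓑) be a matroid given by its bases, with rank function r(A) = max_{B ∈ 𝓑} |A ∩ B|, and let < be any total order on E. Then, as an identity of polynomials in x and y: Σ_{A ⊆ E} (x−1)^{r(E) − r(A)} (y−1)^{|A| − r(A)} = Σ_{B ∈ 𝓑} x^{i(B)} y^{j(B)}; that is, the Tutte polynomial of M equals the sum over bases of x^{i(B)} y^{j(B)}, where activities are taken in the delta-matroid sense. -/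
open Finset

/-- The rank function of a matroid given by its bases:
`r(A) = max_{B ∈ 𝓑} |A ∩ B|`. -/
def rankOf {α : Type*} [DecidableEq α] (𝓑 : Finset (Finset α)) (A : Finset α) : ℕ :=
  𝓑.sup (fun B => (A ∩ B).card)

namespace TutteAct

variable {α : Type*} [LinearOrder α]

structure Mat (E : Finset α) (𝓑 : Finset (Finset α)) : Prop where
  sub : ∀ B ∈ 𝓑, B ⊆ E
  card : ∀ B ∈ 𝓑, ∀ B' ∈ 𝓑, B.card = B'.card
  ex : ∀ X ∈ 𝓑, ∀ Y ∈ 𝓑, ∀ x ∈ X \ Y, ∃ y ∈ Y \ X, insert y (X.erase x) ∈ 𝓑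

def Act (𝓑 : Finset (Finset α)) (B : Finset α) (a : α) : Prop :=
  ∀ b, b < a → symmDiff B {b, a} ∉ 𝓑

open Classical in
noncomputable def nAct (𝓑 : Finset (Finset α)) (B A : Finset α) : ℕ :=
  (A.filter fun a => Act 𝓑 B a).card

def del (𝓑 : Finset (Finset α)) (e : α) : Finset (Finset α) := 𝓑.filter (fun B => e ∉ B)
def con (𝓑 : Finset (Finset α)) (e : α) : Finset (Finset α) :=
  (𝓑.filter (fun B => e ∈ B)).image (fun B => B.erase e)

lemma mem_del {𝓑 : Finset (Finset α)} {e : α} {B : Finset α} :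
    B ∈ del 𝓑 e ↔ B ∈ 𝓑 ∧ e ∉ B := by simp [del]

lemma mem_con {𝓑 : Finset (Finset α)} {e : α} {S : Finset α} :
    S ∈ con 𝓑 e ↔ e ∉ S ∧ insert e S ∈ 𝓑 := by
  simp only [con, mem_image, mem_filter]
  constructor
  · rintro ⟨B, ⟨hB, he⟩, rfl⟩
    simp [insert_erase he, hB]
  · rintro ⟨h, h'⟩
    exact ⟨insert e S, ⟨h', by simp⟩, by simp [h]⟩

lemma Mat.nonor {E : Finset α} {𝓑 : Finset (Finset α)} (h : Mat E 𝓑) {B : Finset α}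
    (hB : B ∈ 𝓑) (a : α) : ¬ FNonorientable 𝓑 B a := by
  intro hn
  have h1 := h.card _ hB _ hn
  by_cases ha : a ∈ B
  · have : symmDiff B {a} = B.erase a := by ext z; simp [mem_symmDiff]; grind
    rw [this, card_erase_of_mem ha] at h1
    have := card_pos.2 ⟨a, ha⟩
    omega
  · have : symmDiff B {a} = insert a B := by ext z; simp [mem_symmDiff]; grind
    rw [this, card_insert_of_notMem ha] at h1
    omega

open Classical in
lemma Mat.numAct {E : Finset α} {𝓑 : Finset (Finset α)} (h : Mat E 𝓑) {B : Finset α}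
    (hB : B ∈ 𝓑) (A : Finset α) : numActOr 𝓑 B A = nAct 𝓑 B A := by
  unfold numActOr nAct
  congr 1
  apply filter_congr
  intro a _
  simp only [ActiveWrt, FInterlaced, Act, h.nonor hB]
  constructor
  · intro h1 b hb hm
    exact h1.1 b hb ⟨hb.ne, Or.inl ⟨by simp, hm⟩⟩
  · intro h1
    refine ⟨fun b hb hm => h1 b hb ?_, by simp⟩
    simpa using hm.2

lemma Mat.del {E : Finset α} {𝓑 : Finset (Finset α)} {e : α}
    (h : Mat (insert e E) 𝓑) : Mat E (del 𝓑 e) where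
  sub B hB := by
    rw [mem_del] at hB
    exact (subset_insert_iff_of_notMem hB.2).1 (h.sub B hB.1)
  card B hB B' hB' := h.card B (mem_del.1 hB).1 B' (mem_del.1 hB').1
  ex X hX Y hY x hx := by
    rw [mem_del] at hX hY
    obtain ⟨y, hy, hyy⟩ := h.ex X hX.1 Y hY.1 x hx
    refine ⟨y, hy, mem_del.2 ⟨hyy, ?_⟩⟩
    grind

lemma Mat.con {E : Finset α} {𝓑 : Finset (Finset α)} {e : α}
    (h : Mat (insert e E) 𝓑) : Mat E (con 𝓑 e) where
  sub B hB := by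
    rw [mem_con] at hB
    intro z hz
    have := h.sub _ hB.2 (mem_insert_of_mem hz)
    grind
  card B hB B' hB' := by
    rw [mem_con] at hB hB'
    have := h.card _ hB.2 _ hB'.2
    rw [card_insert_of_notMem hB.1, card_insert_of_notMem hB'.1] at this
    omega
  ex X hX Y hY x hx := by
    rw [mem_con] at hX hY
    obtain ⟨y, hy, hyy⟩ := h.ex _ hX.2 _ hY.2 x (by grind)
    refine ⟨y, by grind, mem_con.2 ⟨by grind, ?_⟩⟩
    convert hyy using 1
    grind

lemma Mat.dual {E : Finset α} {𝓑 : Finset (Finset α)} (h : Mat E 𝓑) {B : Finset α} {e : α}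
    (hB : B ∈ 𝓑) (he : e ∉ B) :
    ∀ n : ℕ, ∀ Y ∈ 𝓑, e ∈ Y → (Y \ B).card = n → ∃ x ∈ B, insert e (B.erase x) ∈ 𝓑 := by
  intro n
  induction n using Nat.strong_induction_on with
  | _ n ih =>
    intro Y hY heY hn
    by_cases hy : ∃ y ∈ Y \ B, y ≠ e
    · obtain ⟨y, hy, hye⟩ := hy
      obtain ⟨b, hb, hbb⟩ := h.ex Y hY B hB y hy
      have hlt : (insert b (Y.erase y) \ B).card < n := by
        rw [← hn]
        apply card_lt_card
        rw [ssubset_iff_of_subset (by grind)]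
        exact ⟨y, hy, by grind⟩
      exact ih _ hlt _ hbb (by grind) rfl
    · push Not at hy
      have hc := h.card B hB Y hY
      have h1 : Y \ B = {e} := by ext z; grind
      have h2 : (B \ Y).card = 1 := by
        rw [card_sdiff_comm hc, h1]; simp
      obtain ⟨x, hx⟩ := card_eq_one.1 h2
      have hxB : x ∈ B \ Y := by simp [hx]
      refine ⟨x, by grind, ?_⟩
      have : insert e (B.erase x) = Y := by
        ext z
        have a1 : z ∈ Y \ B ↔ z = e := by simp [h1]
        have a2 : z ∈ B \ Y ↔ z = x := by simp [hx]
        grind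
      rw [this]; exact hY

lemma rank_le_iff {𝓑 : Finset (Finset α)} {A : Finset α} {n : ℕ} :
    rankOf 𝓑 A ≤ n ↔ ∀ B ∈ 𝓑, (A ∩ B).card ≤ n := by
  simp [rankOf]

lemma le_rank {𝓑 : Finset (Finset α)} (A : Finset α) {B : Finset α} (hB : B ∈ 𝓑) :
    (A ∩ B).card ≤ rankOf 𝓑 A := rank_le_iff.1 le_rfl B hB

lemma rank_le_card (𝓑 : Finset (Finset α)) (A : Finset α) : rankOf 𝓑 A ≤ A.card :=
  rank_le_iff.2 fun _ _ => card_le_card inter_subset_left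

lemma rank_mono (𝓑 : Finset (Finset α)) {A A' : Finset α} (h : A ⊆ A') :
    rankOf 𝓑 A ≤ rankOf 𝓑 A' :=
  rank_le_iff.2 fun _ hB => (card_le_card (inter_subset_inter_right h)).trans (le_rank A' hB)

section
variable {E : Finset α} {𝓑 : Finset (Finset α)} {e : α} {A : Finset α}

lemma rank_del (h : Mat (insert e E) 𝓑) (h0 : (del 𝓑 e).Nonempty) (hA : e ∉ A) :
    rankOf 𝓑 A = rankOf (del 𝓑 e) A := by
  apply le_antisymm
  · rw [rank_le_iff]
    intro B hB
    by_cases he : e ∈ B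
    · obtain ⟨Y, hY⟩ := h0
      rw [mem_del] at hY
      obtain ⟨y, hy, hyy⟩ := h.ex B hB Y hY.1 e (by grind)
      refine le_trans (card_le_card ?_) (le_rank A (mem_del.2 ⟨hyy, by grind⟩))
      grind
    · exact le_rank A (mem_del.2 ⟨hB, he⟩)
  · rw [rank_le_iff]
    intro B hB
    exact le_rank A (mem_del.1 hB).1

lemma rank_con (h : Mat (insert e E) 𝓑) (h1 : (con 𝓑 e).Nonempty) (hA : e ∉ A) :
    rankOf 𝓑 (insert e A) = rankOf (con 𝓑 e) A + 1 := by
  have key : ∀ S, e ∉ S → (insert e A ∩ insert e S).card = (A ∩ S).card + 1 := by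
    intro S hS
    rw [← insert_inter_distrib, card_insert_of_notMem (by grind)]
  apply le_antisymm
  · rw [rank_le_iff]
    intro B hB
    by_cases he : e ∈ B
    · have := key (B.erase e) (by simp)
      rw [insert_erase he] at this
      rw [this]
      have := le_rank A (mem_con.2 ⟨by simp, by rwa [insert_erase he]⟩ : B.erase e ∈ con 𝓑 e)
      omega
    · obtain ⟨S, hS⟩ := h1
      rw [mem_con] at hS
      obtain ⟨x, hx, hxx⟩ := h.dual hB he _ _ hS.2 (by simp) rfl
      have := le_rank A (mem_con.2 ⟨by grind, hxx⟩ : B.erase x ∈ con 𝓑 e)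
      have h3 : (insert e A ∩ B).card ≤ (insert x (A ∩ B.erase x)).card :=
        card_le_card (by grind)
      have := card_insert_le x (A ∩ B.erase x)
      omega
  · obtain ⟨S, hS, hm⟩ := exists_mem_eq_sup (con 𝓑 e) h1 (fun B => (A ∩ B).card)
    have : rankOf (con 𝓑 e) A = (A ∩ S).card := hm
    rw [mem_con] at hS
    rw [this, ← key S hS.1]
    exact le_rank _ hS.2

lemma rank_coloop (h0 : ¬ (del 𝓑 e).Nonempty) (hA : e ∉ A) :
    rankOf 𝓑 A = rankOf (con 𝓑 e) A := by
  have h0 : ∀ B ∈ 𝓑, e ∈ B := fun B hB => by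
    by_contra hc; exact h0 ⟨B, mem_del.2 ⟨hB, hc⟩⟩
  apply le_antisymm
  · rw [rank_le_iff]
    intro B hB
    refine le_trans (card_le_card ?_) (le_rank A (mem_con.2 ⟨by simp, by rwa [insert_erase (h0 B hB)]⟩ : B.erase e ∈ con 𝓑 e))
    grind
  · rw [rank_le_iff]
    intro B hB
    refine le_trans (card_le_card ?_) (le_rank A (mem_con.1 hB).2)
    grind

lemma rank_loop (h1 : ¬ (con 𝓑 e).Nonempty) :
    rankOf 𝓑 (insert e A) = rankOf (del 𝓑 e) A := by
  have h1 : ∀ B ∈ 𝓑, e ∉ B := fun B hB he => 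
    h1 ⟨B.erase e, mem_con.2 ⟨by simp, by rwa [insert_erase he]⟩⟩
  have : del 𝓑 e = 𝓑 := by ext; simp [mem_del]; grind
  rw [this]
  unfold rankOf
  apply sup_congr rfl
  intro B hB
  have := h1 B hB
  congr 1
  grind

lemma act_del {B : Finset α} {a : α} (hB : e ∉ B) (ha : a < e) :
    Act 𝓑 B a ↔ Act (del 𝓑 e) B a := by
  refine forall₂_congr fun b hb => not_congr ?_
  rw [mem_del, iff_self_and]
  intro _
  have := hb.trans ha
  simp [mem_symmDiff, hB, ha.ne', this.ne']

lemma act_con {S : Finset α} {a : α} (hS : e ∉ S) (ha : a < e) :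
    Act 𝓑 (insert e S) a ↔ Act (con 𝓑 e) S a := by
  refine forall₂_congr fun b hb => not_congr ?_
  have hbe := hb.trans ha
  have h1 : e ∉ symmDiff S {b, a} := by simp [mem_symmDiff, hS, ha.ne', hbe.ne']
  have h2 : symmDiff (insert e S) {b, a} = insert e (symmDiff S {b, a}) := by
    ext z
    by_cases hz : z = e
    · subst hz; simp [mem_symmDiff, ha.ne', hbe.ne']
    · simp [mem_symmDiff, hz]
  rw [mem_con, h2]
  simp [h1]

lemma act_e_in (h : Mat (insert e E) 𝓑) (hE : ∀ x ∈ E, x < e) {B : Finset α} (hB : B ∈ 𝓑)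
    (he : e ∈ B) : Act 𝓑 B e ↔ ¬ (del 𝓑 e).Nonempty := by
  constructor
  · rintro ha ⟨Y, hY⟩
    rw [mem_del] at hY
    obtain ⟨y, hy, hyy⟩ := h.ex B hB Y hY.1 e (by grind)
    have hyE := h.sub Y hY.1 (mem_sdiff.1 hy).1
    refine ha y (hE y (by grind)) ?_
    convert hyy using 1
    ext z; simp only [mem_symmDiff, mem_insert, mem_singleton, mem_erase]; grind
  · intro h0 b hb hm
    exact h0 ⟨_, mem_del.2 ⟨hm, by simp [mem_symmDiff, he]⟩⟩

lemma act_e_out (h : Mat (insert e E) 𝓑) (hE : ∀ x ∈ E, x < e) {B : Finset α} (hB : B ∈ 𝓑)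
    (he : e ∉ B) : Act 𝓑 B e ↔ ¬ (con 𝓑 e).Nonempty := by
  constructor
  · rintro ha ⟨S, hS⟩
    rw [mem_con] at hS
    obtain ⟨x, hx, hxx⟩ := h.dual hB he _ _ hS.2 (by simp) rfl
    have hyE := h.sub B hB hx
    refine ha x (hE x (by grind)) ?_
    convert hxx using 1
    ext z; simp only [mem_symmDiff, mem_insert, mem_singleton, mem_erase]; grind
  · intro h0 b hb hm
    have he' : e ∈ symmDiff B {b, e} := by simp [mem_symmDiff, he]
    exact h0 ⟨(symmDiff B {b, e}).erase e, mem_con.2 ⟨by simp, by rwa [insert_erase he']⟩⟩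

open Classical in
lemma nAct_insert (B : Finset α) (hA : e ∉ A) :
    nAct 𝓑 B (insert e A) = nAct 𝓑 B A + if Act 𝓑 B e then 1 else 0 := by
  unfold nAct
  rw [filter_insert]
  split_ifs
  · rw [card_insert_of_notMem (by simp [hA])]
  · rfl

open Classical in
lemma nAct_del {B : Finset α} (hB : e ∉ B) (hA : ∀ x ∈ A, x < e) :
    nAct 𝓑 B A = nAct (del 𝓑 e) B A := by
  unfold nAct
  congr 1
  exact filter_congr fun a ha => act_del hB (hA a ha)

open Classical in
lemma nAct_con {S : Finset α} (hB : e ∉ S) (hA : ∀ x ∈ A, x < e) :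
    nAct 𝓑 (insert e S) A = nAct (con 𝓑 e) S A := by
  unfold nAct
  congr 1
  exact filter_congr fun a ha => act_con hB (hA a ha)

noncomputable def W (x y : ℝ) (E : Finset α) (𝓑 : Finset (Finset α)) : ℝ :=
  ∑ B ∈ 𝓑, x ^ nAct 𝓑 B B * y ^ nAct 𝓑 B (E \ B)

open Classical in
lemma W_rec (x y : ℝ) (h : Mat (insert e E) 𝓑) (hE : ∀ x ∈ E, x < e) :
    W x y (insert e E) 𝓑 = (if (con 𝓑 e).Nonempty then 1 else y) * W x y E (del 𝓑 e)
      + (if (del 𝓑 e).Nonempty then 1 else x) * W x y E (con 𝓑 e) := by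
  have heE : e ∉ E := fun hh => lt_irrefl _ (hE e hh)
  unfold W
  rw [← sum_filter_add_sum_filter_not 𝓑 (fun B => e ∉ B), mul_sum, mul_sum]
  congr 1
  · apply sum_congr rfl
    intro B hB
    have hBE := h.del.sub B hB
    rw [mem_filter] at hB
    have : insert e E \ B = insert e (E \ B) := by grind
    rw [this, nAct_insert B (by grind), nAct_del (𝓑 := 𝓑) (A := B) hB.2 (fun z hz => hE z (hBE hz)),
      nAct_del (𝓑 := 𝓑) (A := E \ B) hB.2 (fun z hz => hE z (by grind))]
    simp only [act_e_out h hE hB.1 hB.2]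
    split_ifs <;> first | contradiction | (simp only [pow_succ, add_zero]; ring)
  · simp only [not_not]
    symm
    apply sum_bij (fun S _ => insert e S)
    · intro S hS
      rw [mem_con] at hS
      simp [hS.2]
    · intro S hS T hT hh
      rw [mem_con] at hS hT
      rw [← erase_insert hS.1, hh, erase_insert hT.1]
    · intro B hB
      rw [mem_filter] at hB
      exact ⟨B.erase e, mem_con.2 ⟨by simp, by rw [insert_erase hB.2]; exact hB.1⟩,
        insert_erase hB.2⟩
    · intro S hS
      have hSE := h.con.sub S hS
      rw [mem_con] at hS
      have : insert e E \ insert e S = E \ S := by grind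
      rw [this, nAct_insert _ hS.1, nAct_con (𝓑 := 𝓑) (A := S) hS.1 (fun z hz => hE z (hSE hz)),
        nAct_con (𝓑 := 𝓑) (A := E \ S) hS.1 (fun z hz => hE z (by grind))]
      simp only [act_e_in h hE hS.2 (mem_insert_self _ _)]
      split_ifs <;> first | contradiction | (simp only [pow_succ, add_zero]; ring)

end

noncomputable def T (x y : ℝ) (E : Finset α) (𝓑 : Finset (Finset α)) : ℝ :=
  ∑ A ∈ E.powerset,
    (x - 1) ^ (rankOf 𝓑 E - rankOf 𝓑 A) * (y - 1) ^ (A.card - rankOf 𝓑 A)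

lemma main (x y : ℝ) (E : Finset α) :
    ∀ 𝓑 : Finset (Finset α), 𝓑.Nonempty → Mat E 𝓑 → T x y E 𝓑 = W x y E 𝓑 := by
  induction E using Finset.induction_on_max with
  | empty =>
    intro 𝓑 hne h
    have : 𝓑 = {∅} := by
      rw [eq_singleton_iff_nonempty_unique_mem]
      exact ⟨hne, fun B hB => subset_empty.1 (h.sub B hB)⟩
    subst this
    simp [T, W, nAct, rankOf]
  | insert e E hE ih =>
    intro 𝓑 hne h
    have heE : e ∉ E := fun hh => lt_irrefl _ (hE e hh)
    rw [W_rec x y h hE]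
    have hor : (del 𝓑 e).Nonempty ∨ (con 𝓑 e).Nonempty := by
      obtain ⟨B, hB⟩ := hne
      by_cases he : e ∈ B
      · exact Or.inr ⟨B.erase e, mem_con.2 ⟨by simp, by rwa [insert_erase he]⟩⟩
      · exact Or.inl ⟨B, mem_del.2 ⟨hB, he⟩⟩
    have hnot : ∀ A ∈ E.powerset, e ∉ A := fun A hA he => heE (mem_powerset.1 hA he)
    unfold T
    rw [sum_powerset_insert heE]
    by_cases h0 : (del 𝓑 e).Nonempty <;> by_cases h1 : (con 𝓑 e).Nonempty
    · rw [if_pos h0, if_pos h1, ← ih _ h0 h.del, ← ih _ h1 h.con, one_mul, one_mul]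
      unfold T
      have hr : rankOf 𝓑 (insert e E) = rankOf (del 𝓑 e) E := by
        apply le_antisymm
        · rw [rank_le_iff]
          intro B hB
          obtain ⟨Y, hY⟩ := h0
          have e1 := h.card B hB Y (mem_del.1 hY).1
          have e2 := le_rank E hY
          rw [inter_eq_right.2 (h.del.sub Y hY)] at e2
          rw [inter_eq_right.2 (h.sub B hB)]
          omega
        · rw [← rank_del h h0 heE]
          exact rank_mono _ (subset_insert _ _)
      congr 1
      · apply sum_congr rfl
        intro A hA
        rw [hr, rank_del h h0 (hnot A hA)]
      · apply sum_congr rfl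
        intro A hA
        rw [rank_con h h1 heE, rank_con h h1 (hnot A hA), card_insert_of_notMem (hnot A hA),
          Nat.add_sub_add_right, Nat.add_sub_add_right]
    · have hc : con 𝓑 e = ∅ := not_nonempty_iff_eq_empty.1 h1
      rw [if_pos h0, if_neg h1, ← ih _ h0 h.del]
      have : W x y E (con 𝓑 e) = 0 := by simp [W, hc]
      rw [this, mul_zero, add_zero]
      unfold T
      rw [← sum_add_distrib, mul_sum]
      apply sum_congr rfl
      intro A hA
      rw [rank_loop h1, rank_loop h1, rank_del h h0 (hnot A hA), card_insert_of_notMem (hnot A hA),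
        Nat.sub_add_comm (rank_le_card _ _), pow_succ]
      ring
    · have hc : del 𝓑 e = ∅ := not_nonempty_iff_eq_empty.1 h0
      rw [if_pos h1, if_neg h0, ← ih _ h1 h.con]
      have : W x y E (del 𝓑 e) = 0 := by simp [W, hc]
      rw [this, mul_zero, zero_add]
      unfold T
      rw [← sum_add_distrib, mul_sum]
      apply sum_congr rfl
      intro A hA
      rw [rank_con h h1 heE, rank_con h h1 (hnot A hA), rank_coloop h0 (hnot A hA),
        card_insert_of_notMem (hnot A hA), Nat.add_sub_add_right, Nat.add_sub_add_right,
        Nat.sub_add_comm (rank_mono _ (mem_powerset.1 hA)), pow_succ]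
      ring
    · exact absurd hor (by simp [h0, h1])

end TutteAct

/-- The Tutte polynomial of a matroid equals the sum over bases of
`x^{i(B)} y^{j(B)}`, where activities are taken in the delta-matroid
sense. -/
theorem tutte_basis_activities_expansion {α : Type*} [LinearOrder α]
    (E : Finset α) (𝓑 : Finset (Finset α))
    (hne : 𝓑.Nonempty) (hsub : ∀ B ∈ 𝓑, B ⊆ E)
    (hcard : ∀ B ∈ 𝓑, ∀ B' ∈ 𝓑, B.card = B'.card)
    (hex : ∀ X ∈ 𝓑, ∀ Y ∈ 𝓑, ∀ x ∈ X \ Y, ∃ y ∈ Y \ X, insert y (X.erase x) ∈ 𝓑) :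
    ∀ x y : ℝ,
      ∑ A ∈ E.powerset,
          (x - 1) ^ (rankOf 𝓑 E - rankOf 𝓑 A) * (y - 1) ^ (A.card - rankOf 𝓑 A) =
        ∑ B ∈ 𝓑, x ^ numActOr 𝓑 B B * y ^ numActOr 𝓑 B (E \ B) := by
  intro x y
  have h : TutteAct.Mat E 𝓑 := ⟨hsub, hcard, hex⟩
  have hm := TutteAct.main x y E 𝓑 hne h
  unfold TutteAct.T TutteAct.W at hm
  rw [hm]
  apply sum_congr rfl
  intro B hB
  rw [h.numAct hB, h.numAct hB]
end
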